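/- Assume, in the setting below, that β₁ = −2, β₋₁ = 0, and dim_F(⊕_{i∈ℤ}A_{i,−2}) ≥ 2. Then A is isomorphic as a ℤ×ℤ-graded Lie algebra to C(α). -/

import Mathlib

open Finsupp

noncomputable section

/-- Bilinear extension of structure constants `c` to the free module with basis `ι`. -/
def brkt {F : Type*} [Field F] {ι : Type*} (c : ι → ι → (ι →₀ F))
    (x y : ι →₀ F) : ι →₀ F :=
  Finsupp.sum x fun i a => Finsupp.sum y fun j b => (a * b) • c i j

/-- Structure constants of `Vir(α)`: `[L_{i,j}, L_{k,ℓ}] = (k−i+(ℓ−j)α) L_{i+k,j+ℓ}`. -/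
def cVir {F : Type*} [Field F] (α : F) (p q : ℤ × ℤ) : (ℤ × ℤ) →₀ F :=
  Finsupp.single (p + q) (((q.1 - p.1 : ℤ) : F) + ((q.2 - p.2 : ℤ) : F) * α)

/-- Structure constants of `D(α,β)`:
`[L_{i,j}, L_{k,ℓ}] = (β(iℓ−jk) + (k−i) + (ℓ−j)α) L_{i+k,j+ℓ}`. -/
def cD {F : Type*} [Field F] (α β : F) (p q : ℤ × ℤ) : (ℤ × ℤ) →₀ F :=
  Finsupp.single (p + q)
    (β * ((p.1 * q.2 - p.2 * q.1 : ℤ) : F) + ((q.1 - p.1 : ℤ) : F) + ((q.2 - p.2 : ℤ) : F) * α)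

/-- The index set `Z = ℤ×ℤ ∖ {(−α,β), (−2α,2β)}`. -/
def ZS {F : Type*} [Field F] (α β : F) : Set (ℤ × ℤ) :=
  {p | ¬((p.1 : F) = -α ∧ (p.2 : F) = β) ∧ ¬((p.1 : F) = -2 * α ∧ (p.2 : F) = 2 * β)}

/-- Index set of `B(α,β;a₁,a₂,a₂′)`: the points of `Z`, together with the central
elements `c₁` (present iff `(−α,β) ∈ ℤ×ℤ`) and `c₂` (present iff `(−2α,2β) ∈ ℤ×ℤ`). -/
def BES {F : Type*} [Field F] (α β : F) : Set ((ℤ × ℤ) ⊕ Fin 2) :=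
  {x | Sum.elim (fun p : ℤ × ℤ => p ∈ ZS α β)
    (fun t : Fin 2 =>
      if t = 0 then ∃ p : ℤ × ℤ, (p.1 : F) = -α ∧ (p.2 : F) = β
      else ∃ p : ℤ × ℤ, (p.1 : F) = -2 * α ∧ (p.2 : F) = 2 * β) x}

/-- `degMatch α β x p` says the basis element indexed by `x` has degree `p`:
`L_q` has degree `q`, `c₁` has degree `(−α,β)` and `c₂` has degree `(−2α,2β)`. -/
def degMatch {F : Type*} [Field F] (α β : F) (x : (ℤ × ℤ) ⊕ Fin 2) (p : ℤ × ℤ) : Prop :=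
  Sum.elim (fun q : ℤ × ℤ => q = p)
    (fun t : Fin 2 =>
      if t = 0 then ((p.1 : F) = -α ∧ (p.2 : F) = β)
      else ((p.1 : F) = -2 * α ∧ (p.2 : F) = 2 * β)) x

/-- The `(i,j)`-homogeneous component of a Block-type algebra with index set `S`. -/
def gradeS {F : Type*} [Field F] (α β : F) (S : Set ((ℤ × ℤ) ⊕ Fin 2)) (p : ℤ × ℤ) :
    Submodule F (↥S →₀ F) :=
  Submodule.span F {v | ∃ x : ↥S, degMatch α β x.1 p ∧ v = Finsupp.single x 1}

-- Structure constants of the central extension `B(α,β;a₁,a₂,a₂′)` of the Block algebra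
-- (restricted to an index set `S`, with the convention that basis elements outside `S`
-- are zero):
-- `[L_{i,j},L_{k,ℓ}] = ((i+α)(ℓ−β)−(k+α)(j−β)) L_{i+k,j+ℓ}`
--   `+ δ_{i+k,−α} δ_{j+ℓ,β} (αj+βi) a₁ c₁ + δ_{i+k,−2α} δ_{j+ℓ,2β} (a₂(αj+βi)+a₂′(α+i)) c₂`,
-- with `c₁, c₂` central.
open Classical in
def cBlk {F : Type*} [Field F] (α β a1 a2 a2' : F) (S : Set ((ℤ × ℤ) ⊕ Fin 2)) :
    ↥S → ↥S → (↥S →₀ F) := fun x y =>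
  match x, y with
  | ⟨Sum.inl p, _⟩, ⟨Sum.inl q, _⟩ =>
      (if h : (Sum.inl (p + q) : (ℤ × ℤ) ⊕ Fin 2) ∈ S then
        Finsupp.single ⟨Sum.inl (p + q), h⟩
          (((p.1 : F) + α) * ((q.2 : F) - β) - ((q.1 : F) + α) * ((p.2 : F) - β))
      else 0)
      + (if h : (Sum.inr 0 : (ℤ × ℤ) ⊕ Fin 2) ∈ S then
          Finsupp.single ⟨Sum.inr 0, h⟩
            (if ((p.1 + q.1 : ℤ) : F) = -α ∧ ((p.2 + q.2 : ℤ) : F) = β then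
              (α * (p.2 : F) + β * (p.1 : F)) * a1
            else 0)
        else 0)
      + (if h : (Sum.inr 1 : (ℤ × ℤ) ⊕ Fin 2) ∈ S then
          Finsupp.single ⟨Sum.inr 1, h⟩
            (if ((p.1 + q.1 : ℤ) : F) = -2 * α ∧ ((p.2 + q.2 : ℤ) : F) = 2 * β then
              a2 * (α * (p.2 : F) + β * (p.1 : F)) + a2' * (α + (p.1 : F))
            else 0)
        else 0)
  | _, _ => 0

/-- The coefficients `a_{i,j,k,ℓ}` of `C(α)` in the explicitly listed cases. -/
def aC0 {F : Type*} [Field F] (α : F) (i j k l : ℤ) : F :=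
  if -1 ≤ j ∧ -1 ≤ l ∧ -1 ≤ j + l then
    ((k * (j + 1) - (l + 1) * i : ℤ) : F) + ((l - j : ℤ) : F) * α
  else if j = -1 ∧ l = -1 then ((k - i : ℤ) : F)
  else if 0 ≤ j ∧ l ≤ -2 then
    (if 0 ≤ -l - j - 2 then
      (((-l - 2).toNat.factorial / (-l - j - 2).toNat.factorial : ℕ) : F) *
        (((k * (j + 1) - (l + 1) * i : ℤ) : F) + ((l - j : ℤ) : F) * α)
    else 0)
  else if j = -1 ∧ l ≤ -2 then -α + (i : F)
  else 0

/-- The full family of coefficients `a_{i,j,k,ℓ}` of `C(α)`; in the remaining cases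
they are given by anticommutativity: `a_{i,j,k,ℓ} = −a_{k,ℓ,i,j}`. -/
def aC {F : Type*} [Field F] (α : F) (i j k l : ℤ) : F :=
  if -1 ≤ j ∨ l ≤ -2 then aC0 α i j k l else -aC0 α k l i j

/-- Structure constants of `C(α)`: `[L_{i,j}, L_{k,ℓ}] = a_{i,j,k,ℓ} L_{i+k,j+ℓ}`. -/
def cC {F : Type*} [Field F] (α : F) (p q : ℤ × ℤ) : (ℤ × ℤ) →₀ F :=
  Finsupp.single (p + q) (aC α p.1 p.2 q.1 q.2)

/-- `A` is isomorphic, as a ℤ×ℤ-graded Lie algebra, to the free module `ι →₀ F`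
equipped with the (bilinear) bracket `b` and the grading `g`. -/
def GradedIsoTo (F : Type*) [Field F] (L : Type*) [LieRing L] [LieAlgebra F L]
    (comp : ℤ × ℤ → Submodule F L) {ι : Type*}
    (b : (ι →₀ F) → (ι →₀ F) → (ι →₀ F)) (g : ℤ × ℤ → Submodule F (ι →₀ F)) : Prop :=
  ∃ eqv : L ≃ₗ[F] (ι →₀ F),
    (∀ x y : L, eqv ⁅x, y⁆ = b (eqv x) (eqv y)) ∧
    ∀ p : ℤ × ℤ, (comp p).map (eqv : L →ₗ[F] (ι →₀ F)) = g p

/-- A ℤ×ℤ-graded Lie algebra `A = ⊕_{i,j} A_{i,j}` over `F` with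
`dim A_{i,j} ≤ 1`, satisfying conditions (1)–(3):
(1) `A₀ = ⊕_i A_{i,0}` is (isomorphic to) the centerless Virasoro algebra, with
`A_{i,0}` spanned by `L_{i,0}` (= `e i`);
(2) `A_{0,−1} ⊕ A_{0,0} ⊕ A_{0,1}` is a Lie subalgebra isomorphic to `sl₂(F)`;
(3) `A` is generated by `A₀ ∪ A_{0,1} ∪ A_{0,−1}`. -/
structure SuSetting (F : Type*) [Field F] (L : Type*) [LieRing L] [LieAlgebra F L] where
  comp : ℤ × ℤ → Submodule F L
  internal : DirectSum.IsInternal comp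
  brMem : ∀ (p q : ℤ × ℤ) (x y : L), x ∈ comp p → y ∈ comp q → ⁅x, y⁆ ∈ comp (p + q)
  rankLe : ∀ p : ℤ × ℤ, Module.rank F ↥(comp p) ≤ 1
  e : ℤ → L
  e_ne : ∀ i : ℤ, e i ≠ 0
  e_span : ∀ i : ℤ, comp (i, 0) = Submodule.span F {e i}
  e_br : ∀ i j : ℤ, ⁅e i, e j⁆ = ((j - i : ℤ) : F) • e (i + j)
  sl2 : ∃ S : LieSubalgebra F L,
    S.toSubmodule = comp (0, -1) ⊔ comp (0, 0) ⊔ comp (0, 1) ∧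
    Nonempty (S ≃ₗ⁅F⁆ ↥(LieAlgebra.SpecialLinear.sl (Fin 2) F))
  gen : LieSubalgebra.lieSpan F L
      ((⋃ i : ℤ, (comp (i, 0) : Set L)) ∪ (comp (0, 1) : Set L) ∪ (comp (0, -1) : Set L)) = ⊤

/-- An integer avoiding two prescribed values in a field of characteristic zero. -/
lemma exists_int_ne_ne {F : Type*} [Field F] [CharZero F] (a b : F) :
    ∃ n : ℤ, (n : F) ≠ a ∧ (n : F) ≠ b := by
  by_contra! h
  have h0 := h 0
  have h1 := h 1
  have h2 := h 2
  by_cases c0 : ((0 : ℤ) : F) = a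
  · by_cases c1 : ((1 : ℤ) : F) = a
    · exact absurd (Int.cast_injective (c0.trans c1.symm)) (by norm_num)
    · by_cases c2 : ((2 : ℤ) : F) = a
      · exact absurd (Int.cast_injective (c0.trans c2.symm)) (by norm_num)
      · exact absurd (Int.cast_injective ((h1 c1).trans (h2 c2).symm)) (by norm_num)
  · by_cases c1 : ((1 : ℤ) : F) = a
    · by_cases c2 : ((2 : ℤ) : F) = a
      · exact absurd (Int.cast_injective (c1.trans c2.symm)) (by norm_num)
      · exact absurd (Int.cast_injective ((h0 c0).trans (h2 c2).symm)) (by norm_num)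
    · exact absurd (Int.cast_injective ((h0 c0).trans (h1 c1).symm)) (by norm_num)

/-- A function on the integers with constant difference is affine. -/
lemma affine_of_diff {F : Type*} [Field F] {φ : ℤ → F} {δ : F}
    (h : ∀ n, φ (n + 1) - φ n = δ) (n : ℤ) :
    φ n = φ 0 + n * δ := by
  induction n using Int.induction_on with
  | zero => simp
  | succ k ih =>
    have := h k
    push_cast at ih ⊢
    linear_combination this + ih
  | pred k ih =>
    have := h (-(k : ℤ) - 1)
    rw [sub_add_cancel] at this
    push_cast at ih ⊢
    linear_combination ih - this

/-- Antisymmetric solutions of the equation expressing equivariance of a bracket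
`F₀ ∧ F₀ → F₁` of density modules. -/
lemma antisymm_form_unique {F : Type*} [Field F] [CharZero F] {α : F} {lam : ℤ → ℤ → F}
    (hanti : ∀ k l, lam l k = -lam k l)
    (hfe : ∀ k l t : ℤ, (t : F) ≠ 2 * α →
      ((t : F) - 2 * α) * lam k l
        = ((k : F) - α) * lam (t - l) l + ((l : F) - α) * lam k (t - k)) :
    ∃ A : F, ∀ k l : ℤ, lam k l = A * ((k : F) - l) := by
  obtain ⟨t, ht, -⟩ := exists_int_ne_ne (2 * α) (2 * α)
  have ht' : (t : F) - 2 * α ≠ 0 := sub_ne_zero.mpr ht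
  let φ : ℤ → F := fun l => lam (t - l) l / ((t : F) - 2 * α)
  have hlam : ∀ k l : ℤ, lam k l = ((k : F) - α) * φ l - ((l : F) - α) * φ k := by
    intro k l
    have h := hfe k l t ht
    rw [hanti (t - k) k] at h
    have hφ : ∀ m : ℤ, ((t : F) - 2 * α) * φ m = lam (t - m) m := fun m => mul_div_cancel₀ _ ht'
    apply mul_left_cancel₀ ht'
    linear_combination h - ((k : F) - α) * hφ l + ((l : F) - α) * hφ k
  have hpair : ∀ k l s : ℤ, (s : F) ≠ 2 * α → (k : F) ≠ α → (l : F) ≠ α →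
      φ k + φ (s - k) = φ l + φ (s - l) := by
    intro k l s hs hk hl
    have h := hfe k l s hs
    rw [hlam k l, hlam (s - l) l, hlam k (s - k)] at h
    push_cast at h
    have : ((k : F) - α) * (((l : F) - α) * (φ k + φ (s - k) - (φ l + φ (s - l)))) = 0 := by
      linear_combination -h
    rcases mul_eq_zero.mp this with h1 | h1
    · exact absurd (sub_eq_zero.mp h1) hk
    rcases mul_eq_zero.mp h1 with h1 | h1
    · exact absurd (sub_eq_zero.mp h1) hl
    exact sub_eq_zero.mp h1
  have hdiff : ∀ a b : ℤ, ((a + b + 1 : ℤ) : F) ≠ 2 * α →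
      φ (a + 1) - φ a = φ (b + 1) - φ b := by
    intro a b hab
    have rep : ∀ k : ℤ, ∃ k' : ℤ, (k' : F) ≠ α ∧
        φ k' + φ (a + b + 1 - k') = φ k + φ (a + b + 1 - k) := by
      intro k
      by_cases hk : (k : F) = α
      · refine ⟨a + b + 1 - k, fun h => hab ?_, ?_⟩
        · push_cast at h ⊢
          linear_combination h + hk
        · rw [sub_sub_cancel, add_comm]
      · exact ⟨k, hk, rfl⟩
    obtain ⟨k, hk, hk'⟩ := rep (a + 1)
    obtain ⟨l, hl, hl'⟩ := rep a
    have h := hpair k l (a + b + 1) hab hk hl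
    rw [hk', hl', show a + b + 1 - (a + 1) = b by ring, show a + b + 1 - a = b + 1 by ring] at h
    linear_combination h
  have hconst : ∀ a : ℤ, φ (a + 1) - φ a = φ 1 - φ 0 := by
    intro a
    obtain ⟨c, h1, h2⟩ := exists_int_ne_ne (2 * α - a - 1) (2 * α - 1)
    rw [hdiff a c, ← hdiff 0 c, zero_add]
    · intro h; apply h2; push_cast at h; linear_combination h
    · intro h; apply h1; push_cast at h; linear_combination h
  refine ⟨φ 0 + α * (φ 1 - φ 0), fun k l => ?_⟩
  rw [hlam, affine_of_diff hconst k, affine_of_diff hconst l]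
  ring

/-- The three-point recurrence satisfied on positive integers forces constancy. -/
lemma three_point_const_pos {F : Type*} [Field F] [CharZero F] {g : ℤ → F}
    (hR : ∀ z k : ℤ, z ≠ 0 → z + k ≠ 0 → z - k ≠ 0 →
      ((z : F) - 2 * k) * (z + k) * (g (z + k) - g z)
        + ((z : F) + 2 * k) * (z - k) * (g (z - k) - g z) = 0) (n : ℕ) :
    g (n + 1) = g 1 := by
  have h21 : g 2 = g 1 := by
    have h := hR 2 1 (by norm_num) (by norm_num) (by norm_num)
    norm_num at h
    linear_combination -h
  have h42 : g 4 = g 2 := by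
    have h := hR 4 2 (by norm_num) (by norm_num) (by norm_num)
    norm_num at h
    linear_combination -h
  have h32 : g 3 = g 2 := by
    have h := hR 3 1 (by norm_num) (by norm_num) (by norm_num)
    norm_num at h
    linear_combination (-1 / 14 : F) * h + (4 / 14 : F) * h42
  induction n using Nat.strong_induction_on with
  | _ n ih =>
    match n with
    | 0 => simp
    | 1 => norm_num [h21]
    | 2 => norm_num [h32, h21]
    | n + 3 =>
      have h := hR ((n : ℤ) + 3) 1 (by omega) (by omega) (by omega)
      have e1 := ih (n + 2) (by omega)
      have e2 := ih (n + 1) (by omega)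
      push_cast at h e1 e2 ⊢
      rw [show (n : ℤ) + 3 = n + 2 + 1 by ring, e1,
        show (n : ℤ) + 2 + 1 - 1 = n + 1 + 1 by ring, e2, sub_self, mul_zero, add_zero] at h
      rcases mul_eq_zero.mp h with h | h
      · exfalso
        rcases mul_eq_zero.mp h with h | h
        · have : ((n + 1 : ℕ) : F) = 0 := by push_cast; linear_combination h
          exact absurd this (Nat.cast_ne_zero.mpr (by omega))
        · have : ((n + 4 : ℕ) : F) = 0 := by push_cast; linear_combination h
          exact absurd this (Nat.cast_ne_zero.mpr (by omega))
      · rw [show (n : ℤ) + 3 + 1 = n + 2 + 1 + 1 by ring]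
        exact sub_eq_zero.mp h

/-- The three-point recurrence on nonzero integers forces constancy. -/
lemma three_point_const {F : Type*} [Field F] [CharZero F] {g : ℤ → F}
    (hR : ∀ z k : ℤ, z ≠ 0 → z + k ≠ 0 → z - k ≠ 0 →
      ((z : F) - 2 * k) * (z + k) * (g (z + k) - g z)
        + ((z : F) + 2 * k) * (z - k) * (g (z - k) - g z) = 0) {z : ℤ} (hz : z ≠ 0) :
    g z = g 1 := by
  have hpos := three_point_const_pos hR
  have hneg := three_point_const_pos (g := fun z => g (-z)) (by
    intro z k h1 h2 h3
    have h := hR (-z) k (by omega) (by omega) (by omega)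
    rw [show -z + k = -(z - k) by ring, show -z - k = -(z + k) by ring] at h
    push_cast at h
    linear_combination h)
  have hone : g (-1) = g 1 := by
    have h := hR 1 2 (by norm_num) (by norm_num) (by norm_num)
    have h3 := hpos 2
    norm_num at h h3
    rw [h3] at h
    linear_combination (-1 / 5 : F) * h
  rcases lt_or_gt_of_ne hz with h | h
  · have := hneg (-z - 1).toNat
    rw [Int.toNat_of_nonneg (by omega)] at this
    simpa [hone] using this
  · have := hpos (z - 1).toNat
    rw [Int.toNat_of_nonneg (by omega)] at this
    simpa using this

/-- Uniqueness of the equivariant pairing `F₀ ⊗ F₋₂ → F₋₁` of density modules. -/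
lemma pairing_unique {F : Type*} [Field F] [CharZero F] {α : F} (hα : α ≠ 0)
    {f : ℤ → ℤ → F} (hf0 : f 0 0 = 2 * α)
    (hE : ∀ k i j : ℤ, (i : F) ≠ α → (i : F) + k ≠ α →
      ((i : F) + j - k) * f i j
        = ((i : F) - α) * f (i + k) j + (α + j - 2 * k) * f i (j + k))
    (i j : ℤ) (hi : (i : F) ≠ α) : f i j = 2 * (α - i) := by
  obtain ⟨g, hg⟩ : ∃ g : ℤ → F, ∀ i : ℤ, (i : F) ≠ α → f i (-i) = (α - i) * g i :=
    ⟨fun i => f i (-i) / (α - i), fun i hi =>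
      (mul_div_cancel₀ _ (sub_ne_zero.mpr hi.symm)).symm⟩
  have hR : ∀ i k : ℤ, (i : F) ≠ α → (i : F) + k ≠ α → (i : F) - k ≠ α →
      ((i : F) - α - 2 * k) * (i - α + k) * (g (i + k) - g i)
        + ((i : F) - α + 2 * k) * (i - α - k) * (g (i - k) - g i) = 0 := by
    intro i k h0 hp hm
    have e1 := hE k i (-i) h0 hp
    have e2 := hE (-k) (i + k) (-i) (by push_cast; exact hp) (by push_cast; simpa using h0)
    have e3 := hE (-k) i (k - i) h0 (by push_cast; rwa [← sub_eq_add_neg])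
    rw [show i + k + -k = i by ring, show -i + -k = -(i + k) by ring,
      hg (i + k) (by push_cast; exact hp), hg i h0] at e2
    rw [show i + -k = i - k by ring, show k - i + -k = -i by ring,
      show k - i = -(i - k) by ring, hg (i - k) (by push_cast; exact hm), hg i h0] at e3
    rw [show -i + k = -(i - k) by ring, hg i h0] at e1
    push_cast at e1 e2 e3
    apply mul_left_cancel₀ (sub_ne_zero.mpr h0)
    linear_combination -(2 * k) * e1 - ((i : F) - α) * e2 + ((i : F) - α + 2 * k) * e3
  have hg0 : g 0 = 2 := by
    have h := hg 0 (by simpa using hα.symm)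
    rw [neg_zero, hf0, Int.cast_zero, sub_zero] at h
    apply mul_left_cancel₀ hα
    linear_combination -h
  have hconst : ∀ i : ℤ, (i : F) ≠ α → g i = 2 := by
    by_cases hN : ∃ N : ℤ, (N : F) = α
    · obtain ⟨N, rfl⟩ := hN
      have hc : ∀ z : ℤ, z ≠ 0 → g (N + z) = g (N + 1) := by
        intro z hz
        refine three_point_const (g := fun z => g (N + z)) ?_ hz
        intro z k h0 hp hm
        have cast_ne : ∀ a : ℤ, a ≠ 0 → ((N + a : ℤ) : F) ≠ N := fun a ha h =>
          ha (by simpa using Int.cast_injective h)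
        have h := hR (N + z) k (cast_ne z h0)
          (by rw [← Int.cast_add, add_assoc]; exact cast_ne _ hp)
          (by rw [← Int.cast_sub, add_sub_assoc]; exact cast_ne _ hm)
        rw [add_assoc, add_sub_assoc] at h
        push_cast at h
        linear_combination h
      intro i hi
      have h1 := hc (i - N) (fun h => hi (by rw [sub_eq_zero.mp h]))
      have h2 := hc (-N) (fun h => hα (by simpa using h))
      rw [add_sub_cancel] at h1
      rw [add_neg_cancel, hg0] at h2
      rw [h1, h2]
    · have hz : ∀ a : ℤ, (a : F) - α ≠ 0 := fun a h => hN ⟨a, sub_eq_zero.mp h⟩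
      have hstep : ∀ a : ℤ, g (a + 1) - g a = 0 := by
        intro a
        have hne : ∀ b : ℤ, (b : F) ≠ α := fun b h => hN ⟨b, h⟩
        have r0 := hR a 1 (hne _) (by exact_mod_cast hne (a + 1)) (by exact_mod_cast hne (a - 1))
        have rp := hR (a + 1) 1 (hne _) (by exact_mod_cast hne (a + 1 + 1))
          (by exact_mod_cast hne (a + 1 - 1))
        have rm := hR (a - 1) 1 (hne _) (by exact_mod_cast hne (a - 1 + 1))
          (by exact_mod_cast hne (a - 1 - 1))
        have r2 := hR a 2 (hne _) (by exact_mod_cast hne (a + 2)) (by exact_mod_cast hne (a - 2))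
        rw [show a + 1 + 1 = a + 2 by ring, show a + 1 - 1 = a by ring] at rp
        rw [show a - 1 + 1 = a by ring, show a - 1 - 1 = a - 2 by ring] at rm
        push_cast at r0 rp rm r2
        have key : ((a : F) - α + 1) * (((a : F) - α) * (g (a + 1) - g a)) = 0 := by
          linear_combination (-1 / 56 : F) * (
            ((a : F) - α + 2) * (a - α + 1) * (a - α - 1) * r2
            - ((a : F) - α + 2) * (a - α + 1) * (a - α - 4) * rp
            - ((a : F) - α + 2) * (a - α - 1) * (a - α + 4) * rm
            - ((a : F) - α + 4) * (2 * (a - α) ^ 2 - 4 * (a - α) - 2) * r0)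
        have h1 : (a : F) - α + 1 ≠ 0 := by
          have := hz (a + 1)
          push_cast at this
          intro h; apply this; linear_combination h
        rcases mul_eq_zero.mp key with h | h
        · exact absurd h h1
        · exact (mul_eq_zero.mp h).resolve_left (hz a)
      intro i _
      rw [affine_of_diff hstep i, hg0]
      ring
  have hgen : ∀ i j : ℤ, (i : F) ≠ α → -(j : F) ≠ α → f i j = 2 * (α - i) := by
    intro i j hi hj
    by_cases hk : i + j = 0
    · rw [show j = -i by omega, hg i hi, hconst i hi]
      ring
    · have h := hE (-(i + j)) i j hi (by push_cast; intro h; apply hj; linear_combination h)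
      rw [show i + -(i + j) = -j by ring, show j + -(i + j) = -i by ring, hg i hi, hconst i hi] at h
      have h' := hg (-j) (by push_cast; exact hj)
      rw [neg_neg, hconst (-j) (by push_cast; exact hj)] at h'
      rw [h'] at h
      push_cast at h
      have hk' : (i : F) + j ≠ 0 := by exact_mod_cast hk
      apply mul_left_cancel₀ (mul_ne_zero two_ne_zero hk')
      linear_combination h
  by_cases hj : -(j : F) = α
  · obtain ⟨c, hc0, hc1⟩ := exists_int_ne_ne 0 (α - i)
    have h := hE c i (j - c) hi (fun h => hc1 (by linear_combination h))
    rw [sub_add_cancel, hgen i (j - c) hi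
      (by push_cast; intro h; apply hc0; linear_combination h - hj),
      hgen (i + c) (j - c) (by push_cast; exact fun h => hc1 (by linear_combination h))
        (by push_cast; intro h; apply hc0; linear_combination h - hj)] at h
    push_cast at h
    apply mul_left_cancel₀ hc0
    linear_combination (1 / 3 : F) * h - (1 / 3 : F) * (f i j - 2 * (α - i)) * hj
  · exact hgen i j hi hj

namespace SuSetting

variable {F : Type*} [Field F] {L : Type*} [LieRing L] [LieAlgebra F L]

/-- Homogeneous components are at most one-dimensional. -/
lemma exists_smul_of_mem (S : SuSetting F L) {p : ℤ × ℤ} {z w : L} (hz : z ∈ S.comp p)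
    (hz0 : z ≠ 0) (hw : w ∈ S.comp p) : ∃ c : F, w = c • z := by
  obtain ⟨v, hv⟩ := (rank_submodule_le_one_iff' _).mp (S.rankLe p)
  obtain ⟨a, rfl⟩ := Submodule.mem_span_singleton.mp (hv hz)
  obtain ⟨b, rfl⟩ := Submodule.mem_span_singleton.mp (hv hw)
  have ha : a ≠ 0 := fun h => hz0 (by rw [h, zero_smul])
  exact ⟨b / a, by rw [smul_smul, div_mul_cancel₀ _ ha]⟩

/-- A nonzero homogeneous element spans its component. -/
lemma comp_eq_span (S : SuSetting F L) {p : ℤ × ℤ} {z : L} (hz : z ∈ S.comp p) (hz0 : z ≠ 0) :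
    S.comp p = Submodule.span F {z} := by
  refine le_antisymm (fun w hw => ?_) (by simpa using hz)
  obtain ⟨c, rfl⟩ := S.exists_smul_of_mem hz hz0 hw
  exact Submodule.smul_mem _ _ (Submodule.mem_span_singleton_self z)

lemma e_mem (S : SuSetting F L) (i : ℤ) : S.e i ∈ S.comp (i, 0) := by
  rw [S.e_span]
  exact Submodule.mem_span_singleton_self _

lemma lie_mem_comp (S : SuSetting F L) {i j k l m n : ℤ} {z w : L} (hz : z ∈ S.comp (i, j))
    (hw : w ∈ S.comp (k, l)) (hm : i + k = m) (hn : j + l = n) : ⁅z, w⁆ ∈ S.comp (m, n) := by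
  subst hm hn
  exact S.brMem _ _ _ _ hz hw

/-- If `d` kills `w` but not `z`, with `z` and `w` of the same degree, then `w = 0`. -/
lemma eq_zero_of_lie_eq_zero (S : SuSetting F L) {p : ℤ × ℤ} {z w d : L} (hz : z ∈ S.comp p)
    (hw : w ∈ S.comp p) (hdz : ⁅d, z⁆ ≠ 0) (hdw : ⁅d, w⁆ = 0) : w = 0 := by
  have hz0 : z ≠ 0 := fun h => hdz (by rw [h, lie_zero])
  obtain ⟨c, rfl⟩ := S.exists_smul_of_mem hz hz0 hw
  rw [lie_smul] at hdw
  rw [(smul_eq_zero.mp hdw).resolve_right hdz, zero_smul]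

/-- The local part of the algebra in the case `β₁ = -2`, `β₋₁ = 0`, with the
action of `A₀` on `A₋₁` normalized at all degrees. -/
structure IsLocalPart (S : SuSetting F L) (α : F) (x y : ℤ → L) : Prop where
  α_ne : α ≠ 0
  x_mem : ∀ k, x k ∈ S.comp (k, -1)
  y_mem : ∀ k, y k ∈ S.comp (k, 1)
  x_ne : ∀ k : ℤ, (k : F) ≠ α → x k ≠ 0
  y_ne : ∀ k, y k ≠ 0
  e_x : ∀ i k n : ℤ, i + k = n → ⁅S.e i, x k⁆ = ((k : F) - α) • x n
  e_y : ∀ i k n : ℤ, i + k = n → ⁅S.e i, y k⁆ = ((k : F) + α - 2 * i) • y n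
  y_x : ∀ j k n : ℤ, j + k = n → ⁅y j, x k⁆ = (2 * ((k : F) - α)) • S.e n

namespace IsLocalPart

variable {S : SuSetting F L} {α : F} {x y : ℤ → L}

lemma y_e (h : S.IsLocalPart α x y) (k i n : ℤ) (hn : k + i = n) :
    ⁅y k, S.e i⁆ = (2 * (i : F) - k - α) • y n := by
  rw [← lie_skew, h.e_y i k n (by omega)]
  module

lemma x_e (h : S.IsLocalPart α x y) (k i n : ℤ) (hn : k + i = n) :
    ⁅x k, S.e i⁆ = (α - k) • x n := by
  rw [← lie_skew, h.e_x i k n (by omega)]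
  module

lemma x_y (h : S.IsLocalPart α x y) (k j n : ℤ) (hn : k + j = n) :
    ⁅x k, y j⁆ = (2 * (α - k)) • S.e n := by
  rw [← lie_skew, h.y_x j k n (by omega)]
  module

lemma y_xx (h : S.IsLocalPart α x y) (j k l : ℤ) : ⁅y j, ⁅x k, x l⁆⁆ = 0 := by
  rw [leibniz_lie, h.y_x j k _ rfl, h.y_x j l _ rfl, smul_lie, lie_smul,
    h.e_x (j + k) l (j + k + l) rfl, h.x_e k (j + l) (j + k + l) (by ring)]
  module

lemma e_xx (h : S.IsLocalPart α x y) (k l t : ℤ) :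
    ⁅S.e (t - k - l), ⁅x k, x l⁆⁆
      = ((k : F) - α) • ⁅x (t - l), x l⁆ + ((l : F) - α) • ⁅x k, x (t - k)⁆ := by
  rw [leibniz_lie, h.e_x (t - k - l) k (t - l) (by ring), h.e_x (t - k - l) l (t - k) (by ring),
    smul_lie, lie_smul]

/-- The adjoint action of `A₀` on elements of `A₋₂` killed by `A₁` is, up to a scalar,
independent of the element. -/
lemma exists_scalar [CharZero F] (h : S.IsLocalPart α x y) {p q : ℤ} {m m₀ : L}
    (hm : m ∈ S.comp (p, -2)) (hm₀ : m₀ ∈ S.comp (q, -2)) (hy : ∀ j, ⁅y j, m⁆ = 0)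
    (hy₀ : ∀ j, ⁅y j, m₀⁆ = 0) (he₀ : ⁅S.e 0, m₀⁆ ≠ 0) :
    ∃ c : F, ∀ t : ℤ, ⁅S.e (t - p), m⁆ = c • ⁅S.e (t - q), m₀⁆ := by
  obtain ⟨n, hn1, hn2⟩ := exists_int_ne_ne (α + p) (α + q)
  have hi : ((n - p : ℤ) : F) - α ≠ 0 := by
    push_cast; intro h; apply hn1; linear_combination h
  have hi₀ : ((n - q : ℤ) : F) - α ≠ 0 := by
    push_cast; intro h; apply hn2; linear_combination h
  have act : ∀ (r : ℤ) (z : L), (∀ j, ⁅y j, z⁆ = 0) → ∀ t : ℤ,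
      ⁅y (t - n), ⁅x (n - r), z⁆⁆ = (2 * (((n - r : ℤ) : F) - α)) • ⁅S.e (t - r), z⁆ := by
    intro r z hz t
    rw [leibniz_lie, h.y_x (t - n) (n - r) (t - r) (by ring), smul_lie, hz, lie_zero, add_zero]
  have hne : ⁅x (n - q), m₀⁆ ≠ 0 := by
    intro h0
    have := act q m₀ hy₀ q
    rw [h0, lie_zero, sub_self] at this
    exact smul_ne_zero (mul_ne_zero two_ne_zero hi₀) he₀ this.symm
  obtain ⟨c, hc⟩ := S.exists_smul_of_mem
    (S.lie_mem_comp (h.x_mem (n - q)) hm₀ (sub_add_cancel n q) (n := -3) rfl) hne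
    (S.lie_mem_comp (h.x_mem (n - p)) hm (sub_add_cancel n p) rfl)
  refine ⟨c * (((n - q : ℤ) : F) - α) / (((n - p : ℤ) : F) - α), fun t => ?_⟩
  have h1 := act p m hy t
  rw [hc, lie_smul, act q m₀ hy₀ t] at h1
  have h2 : ⁅S.e (t - p), m⁆
      = (2 * (((n - p : ℤ) : F) - α))⁻¹ • (2 * (((n - p : ℤ) : F) - α)) • ⁅S.e (t - p), m⁆ := by
    rw [smul_smul, inv_mul_cancel₀ (mul_ne_zero two_ne_zero hi), one_smul]
  rw [h2, ← h1, smul_smul, smul_smul]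
  congr 1
  field_simp

/-- Structure of `A₋₂`, given one nonzero bracket outside degree `2α`. -/
lemma exists_level_neg_two [CharZero F] (h : S.IsLocalPart α x y) {k₀ l₀ : ℤ}
    (hkl : (k₀ : F) + l₀ ≠ 2 * α) (hne : ⁅x k₀, x l₀⁆ ≠ 0) :
    ∃ M : ℤ → L, (∀ s, M s ∈ S.comp (s, -2)) ∧ (∀ s, M s ≠ 0) ∧
      (∀ k l n : ℤ, k + l = n → ⁅x k, x l⁆ = ((l : F) - k) • M n) := by
  have xx_mem : ∀ k l n : ℤ, k + l = n → ⁅x k, x l⁆ ∈ S.comp (n, -2) := fun k l n hn =>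
    S.lie_mem_comp (h.x_mem k) (h.x_mem l) hn rfl
  have e_zero : ∀ k l : ℤ, ⁅S.e 0, ⁅x k, x l⁆⁆ = ((k : F) + l - 2 * α) • ⁅x k, x l⁆ := by
    intro k l
    have := h.e_xx k l (k + l)
    rw [show k + l - k - l = 0 by ring, show k + l - l = k by ring, show k + l - k = l by ring]
      at this
    rw [this]
    module
  obtain ⟨p, hp⟩ : ∃ p, p = k₀ + l₀ := ⟨_, rfl⟩
  have hpF : (p : F) = k₀ + l₀ := by rw [hp]; push_cast; rfl
  have hp' : (p : F) - 2 * α ≠ 0 := by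
    rw [hpF]; exact sub_ne_zero.mpr hkl
  have he₀ : ⁅S.e 0, ⁅x k₀, x l₀⁆⁆ ≠ 0 := by
    rw [e_zero]
    exact smul_ne_zero (sub_ne_zero.mpr hkl) hne
  obtain ⟨u, hu⟩ : ∃ u : ℤ → L, ∀ t, u t = ⁅S.e (t - p), ⁅x k₀, x l₀⁆⁆ := ⟨_, fun _ => rfl⟩
  have hup : u p ≠ 0 := by rw [hu, sub_self]; exact he₀
  have u_mem : ∀ t, u t ∈ S.comp (t, -2) := fun t => by
    rw [hu]
    exact S.lie_mem_comp (S.e_mem _) (xx_mem k₀ l₀ p hp.symm) (by ring) rfl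
  have u_y : ∀ t j, ⁅y j, u t⁆ = 0 := fun t j => by
    rw [hu, leibniz_lie, h.y_e j _ _ rfl, smul_lie, h.y_xx, h.y_xx, lie_zero, smul_zero, add_zero]
  have u_zero : ∀ t, ⁅S.e 0, u t⁆ = ((t : F) - 2 * α) • u t := fun t => by
    rw [hu, leibniz_lie, e_zero, S.e_br, lie_smul, zero_add, smul_lie, ← hpF, ← add_smul]
    push_cast
    congr 1
    ring
  have lam_ex : ∀ k l : ℤ, ∃ c : F, ∀ t : ℤ, ⁅S.e (t - (k + l)), ⁅x k, x l⁆⁆ = c • u t := by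
    intro k l
    simp only [hu]
    exact h.exists_scalar (xx_mem k l _ rfl) (xx_mem k₀ l₀ p hp.symm) (fun j => h.y_xx j k l)
      (fun j => h.y_xx j k₀ l₀) he₀
  choose lam hlam using lam_ex
  have u_act : ∀ s t : ℤ, u t ≠ 0 → ⁅S.e (s - t), u t⁆ = ((t : F) - 2 * α) • u s := by
    intro s t hut
    obtain ⟨c, hc⟩ := h.exists_scalar (u_mem t) (xx_mem k₀ l₀ p hp.symm) (u_y t)
      (fun j => h.y_xx j k₀ l₀) he₀
    simp only [← hu] at hc
    have h0 := hc t
    rw [sub_self, u_zero] at h0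
    rw [hc, smul_left_injective F hut h0]
  have u_ne : ∀ s : ℤ, (s : F) ≠ 2 * α → u s ≠ 0 := by
    intro s hs hus
    have hsp : s ≠ p := fun h => hup (h ▸ hus)
    have h1 := leibniz_lie (S.e (s - p)) (S.e (p - s)) (u p)
    have h2 : ⁅S.e (p - s), u p⁆ = ((p : F) - 2 * α) • u (2 * p - s) := by
      rw [show p - s = 2 * p - s - p by ring]
      exact u_act _ _ hup
    rw [h2, u_act s p hup, hus, S.e_br, smul_zero, lie_zero, add_zero, smul_lie,
      show s - p + (p - s) = 0 by ring, u_zero, lie_smul] at h1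
    have hc : (((p - s - (s - p) : ℤ) : F)) ≠ 0 := by
      rw [Int.cast_ne_zero]; omega
    have h3 : u (2 * p - s) ≠ 0 := by
      intro h0
      rw [h0, lie_zero, smul_zero] at h1
      exact smul_ne_zero hc (smul_ne_zero hp' hup) h1.symm
    have h4 := u_act p (2 * p - s) h3
    rw [show p - (2 * p - s) = s - p by ring] at h4
    rw [h4, smul_smul, smul_smul] at h1
    have h5 := smul_left_injective F hup h1
    push_cast at h5
    have h6 : ((p : F) - 2 * α) * ((s : F) - 2 * α) = 0 := by linear_combination h5
    exact (mul_ne_zero hp' (sub_ne_zero.mpr hs)) h6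
  have t_xx : ∀ k l : ℤ, ((k : F) + l - 2 * α) • ⁅x k, x l⁆ = lam k l • u (k + l) := by
    intro k l
    rw [← hlam, sub_self, e_zero]
  have lam_anti : ∀ k l : ℤ, lam l k = -lam k l := by
    intro k l
    have h1 := hlam l k p
    rw [← lie_skew (x l) (x k), lie_neg, add_comm l k, hlam, ← neg_smul] at h1
    exact (smul_left_injective F hup h1).symm
  obtain ⟨A, hA⟩ := antisymm_form_unique (α := α) lam_anti (by
    intro k l t ht
    apply smul_left_injective F (u_ne t ht)
    have h1 := h.e_xx k l t
    rw [sub_sub, hlam] at h1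
    have h2 := t_xx (t - l) l
    have h3 := t_xx k (t - k)
    rw [sub_add_cancel] at h2
    rw [add_sub_cancel] at h3
    push_cast at h2 h3
    simp only
    rw [mul_smul, h1, add_smul, mul_smul, mul_smul, ← h2, ← h3]
    module)
  have hA0 : A ≠ 0 := by
    rintro rfl
    have h1 := hlam k₀ l₀ p
    rw [hA, zero_mul, zero_smul, ← hp, sub_self] at h1
    exact he₀ h1
  have crit : ∀ t : ℤ, (t : F) = 2 * α → ∀ k l : ℤ, k + l = t →
      ⁅x k, x l⁆ = ((l : F) - k) • (-(2 * α)⁻¹) • ⁅x t, x 0⁆ := by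
    intro t ht
    have rel : ∀ k l : ℤ, (A * ((k : F) - l)) • u t
        = ((k : F) - α) • ⁅x (t - l), x l⁆ - ((l : F) - α) • ⁅x (t - k), x k⁆ := by
      intro k l
      rw [← hA, ← hlam, ← sub_sub, h.e_xx, ← lie_skew (x k)]
      module
    have hu0 : u t = 0 := by
      have h1 := rel 1 0
      have h2 := rel (t - 1) (t - 0)
      simp only [sub_sub_cancel] at h2
      rw [← lie_skew (x 0), ← lie_skew (x 1)] at h2
      push_cast at h1 h2
      rw [ht] at h2
      have h3 : (2 * A) • u t = 0 := by
        linear_combination (norm := module) h1 - h2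
      exact (smul_eq_zero.mp h3).resolve_left (mul_ne_zero two_ne_zero hA0)
    intro k l hkl
    have h1 := rel 0 l
    rw [hu0, smul_zero, sub_zero, show t - l = k by omega] at h1
    have h2 : α • ⁅x k, x l⁆ = (-((l : F) - α)) • ⁅x t, x 0⁆ := by
      push_cast at h1
      linear_combination (norm := module) h1
    have h3 : (k : F) = 2 * α - l := by
      rw [← ht, ← hkl]; push_cast; ring
    have hα := h.α_ne
    have h4 : ⁅x k, x l⁆ = α⁻¹ • α • ⁅x k, x l⁆ := by
      rw [smul_smul, inv_mul_cancel₀ hα, one_smul]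
    rw [h4, h2, h3, smul_smul, smul_smul]
    congr 1
    field_simp
    ring
  classical
  refine ⟨fun t => if (t : F) = 2 * α then (-(2 * α)⁻¹) • ⁅x t, x 0⁆
    else (-(A / ((t : F) - 2 * α))) • u t, fun s => ?_, fun s => ?_, ?_⟩
  · beta_reduce
    split_ifs
    · exact Submodule.smul_mem _ _ (xx_mem _ _ _ (by ring))
    · exact Submodule.smul_mem _ _ (u_mem _)
  · beta_reduce
    split_ifs with hs
    · refine smul_ne_zero (neg_ne_zero.mpr (inv_ne_zero (mul_ne_zero two_ne_zero h.α_ne))) ?_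
      intro h0
      have h1 := hlam s 0 (s + 1)
      rw [h0, lie_zero, hA] at h1
      refine smul_ne_zero (mul_ne_zero hA0 ?_) (u_ne (s + 1) ?_) h1.symm
      · rw [hs, Int.cast_zero, sub_zero]
        exact mul_ne_zero two_ne_zero h.α_ne
      · push_cast
        rw [hs]
        simp
    · exact smul_ne_zero (neg_ne_zero.mpr (div_ne_zero hA0 (sub_ne_zero.mpr hs))) (u_ne s hs)
  · rintro k l n rfl
    beta_reduce
    split_ifs with hs
    · exact crit _ hs k l rfl
    · have hs' : ((k : F) + l - 2 * α) ≠ 0 := by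
        rw [← Int.cast_add]; exact sub_ne_zero.mpr hs
      have h1 := t_xx k l
      have h4 : ⁅x k, x l⁆
          = ((k : F) + l - 2 * α)⁻¹ • ((k : F) + l - 2 * α) • ⁅x k, x l⁆ := by
        rw [smul_smul, inv_mul_cancel₀ hs', one_smul]
      rw [h4, h1, hA, smul_smul, smul_smul]
      push_cast
      congr 1
      field_simp
      ring

end IsLocalPart

end SuSetting

namespace SuSetting

variable {F : Type*} [Field F] {L : Type*} [LieRing L] [LieAlgebra F L]

/-- A subspace containing a generating set and stable under the adjoint action of its elements
is the whole Lie algebra. -/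
lemma eq_top_of_ad_stable {s : Set L} (hs : LieSubalgebra.lieSpan F L s = ⊤) (T : Submodule F L)
    (hsT : s ⊆ T) (hT : ∀ z ∈ s, T ≤ T.comap (LieAlgebra.ad F L z : L →ₗ[F] L)) : T = ⊤ := by
  have stable : ∀ z : L, ∀ w ∈ T, ⁅z, w⁆ ∈ T := by
    intro z
    have hz : z ∈ LieSubalgebra.lieSpan F L s := by rw [hs]; trivial
    induction hz using LieSubalgebra.lieSpan_induction with
    | mem z hz => exact fun w hw => hT z hz hw
    | zero => intro w _; rw [zero_lie]; exact T.zero_mem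
    | add a b _ _ ha hb => intro w hw; rw [add_lie]; exact T.add_mem (ha w hw) (hb w hw)
    | smul c a _ ha => intro w hw; rw [smul_lie]; exact T.smul_mem c (ha w hw)
    | lie a b _ _ ha hb =>
      intro w hw
      rw [lie_lie]
      exact T.sub_mem (ha _ (hb w hw)) (hb _ (ha w hw))
  refine eq_top_iff.mpr fun z _ => ?_
  have hz : z ∈ LieSubalgebra.lieSpan F L s := by rw [hs]; trivial
  induction hz using LieSubalgebra.lieSpan_induction with
  | mem z hz => exact hsT hz
  | zero => exact T.zero_mem
  | add a b _ _ ha hb => exact T.add_mem (ha trivial) (hb trivial)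
  | smul c a _ ha => exact T.smul_mem c (ha trivial)
  | lie a b _ _ _ hb => exact stable a b (hb trivial)

namespace IsLocalPart

variable {S : SuSetting F L} {α : F} {x y : ℤ → L}

/-- The span of the words of length `n` in the `x k` applied to `A₀`. -/
def lower (S : SuSetting F L) (x : ℤ → L) : ℕ → Submodule F L
  | 0 => ⨆ i, S.comp (i, 0)
  | n + 1 => ⨆ k, (lower S x n).map (LieAlgebra.ad F L (x k) : L →ₗ[F] L)

lemma lie_mem_lower {n : ℕ} {d : L} (hd : d ∈ lower S x n) (k : ℤ) :
    ⁅x k, d⁆ ∈ lower S x (n + 1) :=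
  Submodule.mem_iSup_of_mem k (Submodule.mem_map_of_mem hd)

lemma lower_succ_le {n : ℕ} {T : Submodule F L}
    (hT : ∀ k, ∀ d ∈ lower S x n, ⁅x k, d⁆ ∈ T) : lower S x (n + 1) ≤ T :=
  iSup_le fun k => Submodule.map_le_iff_le_comap.mpr fun d hd => hT k d hd

lemma lower_zero_le {T : Submodule F L} (hT : ∀ i, S.e i ∈ T) : lower S x 0 ≤ T := by
  refine iSup_le fun i => ?_
  rw [S.e_span, Submodule.span_singleton_le_iff_mem]
  exact hT i

lemma e_mem_lower (i : ℤ) : S.e i ∈ lower S x 0 := Submodule.mem_iSup_of_mem i (S.e_mem i)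

lemma lower_le_comp (h : S.IsLocalPart α x y) (n : ℕ) :
    lower S x n ≤ ⨆ i, S.comp (i, -(n : ℤ)) := by
  induction n with
  | zero => exact le_of_eq rfl
  | succ n ih =>
    refine lower_succ_le fun k d hd => ?_
    have : (⨆ i, S.comp (i, -(n : ℤ))) ≤ (⨆ i, S.comp (i, -((n + 1 : ℕ) : ℤ))).comap
        (LieAlgebra.ad F L (x k) : L →ₗ[F] L) :=
      iSup_le fun i d hd => Submodule.mem_iSup_of_mem (k + i)
        (S.lie_mem_comp (h.x_mem k) hd rfl (by push_cast; ring))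
    exact this (ih hd)

lemma e_lie_mem_lower (h : S.IsLocalPart α x y) (i : ℤ) (n : ℕ) :
    lower S x n ≤ (lower S x n).comap (LieAlgebra.ad F L (S.e i) : L →ₗ[F] L) := by
  induction n with
  | zero =>
    refine lower_zero_le fun j => ?_
    simp only [Submodule.mem_comap, LieAlgebra.ad_apply, S.e_br]
    exact Submodule.smul_mem _ _ (e_mem_lower _)
  | succ n ih =>
    refine lower_succ_le fun k d hd => ?_
    simp only [Submodule.mem_comap, LieAlgebra.ad_apply]
    rw [leibniz_lie, h.e_x i k _ rfl, smul_lie]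
    exact Submodule.add_mem _ (Submodule.smul_mem _ _ (lie_mem_lower hd _))
      (lie_mem_lower (ih hd) _)

lemma y_lie_mem_lower (h : S.IsLocalPart α x y) (j : ℤ) (n : ℕ) :
    lower S x (n + 1) ≤ (lower S x n).comap (LieAlgebra.ad F L (y j) : L →ₗ[F] L) := by
  induction n with
  | zero =>
    refine lower_succ_le fun k d hd => ?_
    simp only [Submodule.mem_comap, LieAlgebra.ad_apply]
    rw [leibniz_lie, h.y_x j k _ rfl, smul_lie]
    refine Submodule.add_mem _ (Submodule.smul_mem _ _ (h.e_lie_mem_lower _ 0 hd)) ?_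
    have key : lower S x 0 ≤ (lower S x 0).comap
        ((LieAlgebra.ad F L (x k) : L →ₗ[F] L) ∘ₗ (LieAlgebra.ad F L (y j) : L →ₗ[F] L)) := by
      refine lower_zero_le fun i => ?_
      simp only [Submodule.mem_comap, LinearMap.comp_apply, LieAlgebra.ad_apply]
      rw [h.y_e j i _ rfl, lie_smul, h.x_y k _ _ rfl]
      exact Submodule.smul_mem _ _ (Submodule.smul_mem _ _ (e_mem_lower _))
    exact key hd
  | succ n ih =>
    refine lower_succ_le fun k d hd => ?_
    simp only [Submodule.mem_comap, LieAlgebra.ad_apply]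
    rw [leibniz_lie, h.y_x j k _ rfl, smul_lie]
    exact Submodule.add_mem _ (Submodule.smul_mem _ _ (h.e_lie_mem_lower _ _ hd))
      (lie_mem_lower (ih hd) _)

/-- The nonnegative levels together with the words in the `x k` exhaust the algebra. -/
lemma nonneg_sup_lower_eq_top (h : S.IsLocalPart α x y) :
    (⨆ p : {p : ℤ × ℤ // 0 ≤ p.2}, S.comp p) ⊔ ⨆ n, lower S x n = ⊤ := by
  have x0 : x 0 ≠ 0 := h.x_ne 0 (by rw [Int.cast_zero]; exact h.α_ne.symm)
  obtain ⟨V, hV⟩ : ∃ V, V = ⨆ p : {p : ℤ × ℤ // 0 ≤ p.2}, S.comp p := ⟨_, rfl⟩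
  have memV : ∀ {i j : ℤ} {z : L}, 0 ≤ j → z ∈ S.comp (i, j) → z ∈ V := fun {i j z} hj hz => by
    rw [hV]
    exact Submodule.mem_iSup_of_mem (⟨(i, j), hj⟩ : {p : ℤ × ℤ // 0 ≤ p.2}) hz
  rw [← hV]
  obtain ⟨T, hT⟩ : ∃ T, T = V ⊔ ⨆ n, lower S x n := ⟨_, rfl⟩
  rw [← hT]
  have lT : ∀ n, lower S x n ≤ T := fun n => by
    rw [hT]; exact (le_iSup (lower S x) n).trans le_sup_right
  have vT : V ≤ T := by rw [hT]; exact le_sup_left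
  have T_le : ∀ {U : Submodule F L}, (∀ (i j : ℤ), 0 ≤ j → ∀ z ∈ S.comp (i, j), z ∈ U) →
      (∀ n, lower S x n ≤ U) → T ≤ U := by
    intro U h1 h2
    rw [hT, hV]
    exact sup_le (iSup_le fun p z hz => h1 _ _ p.2 z hz) (iSup_le h2)
  have e_st : ∀ i, T ≤ T.comap (LieAlgebra.ad F L (S.e i) : L →ₗ[F] L) := fun i =>
    T_le (fun a b hb z hz => vT (memV hb (S.lie_mem_comp (S.e_mem i) hz rfl (zero_add b))))
      fun n z hz => lT n (h.e_lie_mem_lower i n hz)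
  have y_st : ∀ j, T ≤ T.comap (LieAlgebra.ad F L (y j) : L →ₗ[F] L) := by
    intro j
    refine T_le (fun a b hb z hz => vT (memV (by omega : 0 ≤ 1 + b)
      (S.lie_mem_comp (h.y_mem j) hz rfl rfl))) fun n => ?_
    cases n with
    | zero =>
      refine lower_zero_le fun i => ?_
      exact vT (memV zero_le_one (S.lie_mem_comp (h.y_mem j) (S.e_mem i) rfl rfl))
    | succ n => exact fun z hz => lT n (h.y_lie_mem_lower j n hz)
  have x_st : ∀ k, T ≤ T.comap (LieAlgebra.ad F L (x k) : L →ₗ[F] L) := by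
    intro k
    refine T_le (fun a b hb z hz => ?_) fun n z hz => lT (n + 1) (lie_mem_lower hz k)
    rcases hb.eq_or_lt with rfl | hb
    · exact lT 1 (lie_mem_lower (Submodule.mem_iSup_of_mem a hz) k)
    · exact vT (memV (by omega : 0 ≤ -1 + b) (S.lie_mem_comp (h.x_mem k) hz rfl rfl))
  have of_span : ∀ {p : ℤ × ℤ} {z w : L}, z ∈ S.comp p → z ≠ 0 → w ∈ S.comp p →
      T ≤ T.comap (LieAlgebra.ad F L z : L →ₗ[F] L) →
      T ≤ T.comap (LieAlgebra.ad F L w : L →ₗ[F] L) := by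
    intro p z w hz hz0 hw hs t ht
    obtain ⟨c, rfl⟩ := S.exists_smul_of_mem hz hz0 hw
    rw [Submodule.mem_comap, LieAlgebra.ad_apply, smul_lie]
    exact T.smul_mem c (hs ht)
  refine eq_top_of_ad_stable S.gen T ?_ ?_
  · rintro z ((hz | hz) | hz)
    · obtain ⟨i, hi⟩ := Set.mem_iUnion.mp hz
      exact vT (memV le_rfl hi)
    · exact vT (memV zero_le_one hz)
    · obtain ⟨c, rfl⟩ := S.exists_smul_of_mem (h.x_mem 0) x0 hz
      refine T.smul_mem c (lT 1 ?_)
      have h1 : ⁅x 0, S.e 0⁆ ∈ lower S x 1 := lie_mem_lower (e_mem_lower 0) 0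
      rw [h.x_e 0 0 0 rfl, Int.cast_zero, sub_zero] at h1
      exact (Submodule.smul_mem_iff _ h.α_ne).mp h1
  · rintro z ((hz | hz) | hz)
    · obtain ⟨i, hi⟩ := Set.mem_iUnion.mp hz
      exact of_span (S.e_mem i) (S.e_ne i) hi (e_st i)
    · exact of_span (h.y_mem 0) (h.y_ne 0) hz (y_st 0)
    · exact of_span (h.x_mem 0) x0 hz (x_st 0)

lemma level_neg_two_le_lower (h : S.IsLocalPart α x y) :
    (⨆ i, S.comp (i, -2)) ≤ lower S x 2 := by
  have key : (⊤ : Submodule F L) ≤ lower S x 2 ⊔ ⨆ p ∈ {p : ℤ × ℤ | p.2 ≠ -2}, S.comp p := by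
    rw [← h.nonneg_sup_lower_eq_top]
    have le_rest : ∀ p : ℤ × ℤ, p.2 ≠ -2 →
        S.comp p ≤ lower S x 2 ⊔ ⨆ p ∈ {p : ℤ × ℤ | p.2 ≠ -2}, S.comp p := fun p hp =>
      (le_biSup S.comp (show p ∈ {p : ℤ × ℤ | p.2 ≠ -2} from hp)).trans le_sup_right
    refine sup_le (iSup_le fun p => le_rest p ?_) (iSup_le fun n => ?_)
    · have := p.2
      omega
    · by_cases hn : n = 2
      · rw [hn]
        exact le_sup_left
      · exact (h.lower_le_comp n).trans (iSup_le fun i => le_rest _ (by simp only; omega))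
  have hdisj : Disjoint (⨆ p ∈ {p : ℤ × ℤ | p.2 = -2}, S.comp p)
      (⨆ p ∈ {p : ℤ × ℤ | p.2 ≠ -2}, S.comp p) :=
    S.internal.submodule_iSupIndep.disjoint_biSup_biSup
      (Set.disjoint_left.mpr fun p hp hp' => hp' hp)
  have hle : (⨆ i, S.comp (i, -2)) ≤ ⨆ p ∈ {p : ℤ × ℤ | p.2 = -2}, S.comp p :=
    iSup_le fun i => le_biSup S.comp (show (i, -2) ∈ {p : ℤ × ℤ | p.2 = -2} from rfl)
  have h2 : lower S x 2 ≤ ⨆ i, S.comp (i, -2) := h.lower_le_comp 2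
  intro z hz
  obtain ⟨a, ha, b, hb, rfl⟩ := Submodule.mem_sup.mp (key (Submodule.mem_top (x := z)))
  have hb' : b ∈ ⨆ i, S.comp (i, -2) := by
    have := Submodule.sub_mem _ hz (h2 ha)
    rwa [add_sub_cancel_left] at this
  rw [Submodule.disjoint_def.mp hdisj b (hle hb') hb, add_zero]
  exact ha

/-- If `A₋₂` has dimension at least two, some bracket of degree different from `2α` is nonzero. -/
lemma exists_lie_ne_zero [CharZero F] (h : S.IsLocalPart α x y)
    (hdim : 2 ≤ Module.rank F ↥(⨆ i : ℤ, S.comp (i, -2))) :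
    ∃ k l : ℤ, (k : F) + l ≠ 2 * α ∧ ⁅x k, x l⁆ ≠ 0 := by
  by_contra! hcon
  have le_of : ∀ {T : Submodule F L}, (∀ k l : ℤ, ⁅x k, x l⁆ ∈ T) → lower S x 2 ≤ T := by
    intro T hT
    refine lower_succ_le fun k d hd => ?_
    have : lower S x 1 ≤ T.comap (LieAlgebra.ad F L (x k) : L →ₗ[F] L) := by
      refine lower_succ_le fun l d hd => ?_
      have : lower S x 0 ≤ (T.comap (LieAlgebra.ad F L (x k) : L →ₗ[F] L)).comap
          (LieAlgebra.ad F L (x l) : L →ₗ[F] L) := by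
        refine lower_zero_le fun i => ?_
        simp only [Submodule.mem_comap, LieAlgebra.ad_apply]
        rw [h.x_e l i _ rfl, lie_smul]
        exact T.smul_mem _ (hT _ _)
      exact this hd
    exact this hd
  obtain ⟨p, hp⟩ : ∃ p, lower S x 2 ≤ S.comp p := by
    by_cases ht : ∃ t : ℤ, (t : F) = 2 * α
    · obtain ⟨t, ht⟩ := ht
      refine ⟨(t, -2), le_of fun k l => ?_⟩
      by_cases hkl : (k : F) + l = 2 * α
      · exact S.lie_mem_comp (h.x_mem k) (h.x_mem l) (by exact_mod_cast hkl.trans ht.symm) rfl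
      · rw [hcon k l hkl]
        exact Submodule.zero_mem _
    · refine ⟨0, le_of fun k l => ?_⟩
      rw [hcon k l fun h0 => ht ⟨k + l, by push_cast; exact h0⟩]
      exact Submodule.zero_mem _
  have h1 := (Submodule.rank_mono (h.level_neg_two_le_lower.trans hp)).trans (S.rankLe p)
  exact absurd (hdim.trans h1) (by norm_num)

end IsLocalPart

end SuSetting

namespace SuSetting

variable {F : Type*} [Field F] {L : Type*} [LieRing L] [LieAlgebra F L]

/-- Two elements of the same degree are compared by applying some `d` not killing the first. -/
lemma eq_smul_of_lie_eq (S : SuSetting F L) {p : ℤ × ℤ} {z w d : L} {c : F} (hz : z ∈ S.comp p)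
    (hw : w ∈ S.comp p) (hdz : ⁅d, z⁆ ≠ 0) (hdw : ⁅d, w⁆ = c • ⁅d, z⁆) : w = c • z :=
  sub_eq_zero.mp (S.eq_zero_of_lie_eq_zero hz
    (Submodule.sub_mem _ hw (Submodule.smul_mem _ c hz)) hdz
    (by rw [lie_sub, lie_smul, hdw, sub_self]))

/-- The basis of the nonnegative levels, built from `A₀` by applying the `y i`. -/
def upper (S : SuSetting F L) (α : F) (y : ℤ → L) : ℕ → ℤ → L
  | 0, n => S.e n
  | 1, n => y n
  | l + 2, n =>
    open Classical in
    if 2 * (n : F) + l * α ≠ 0 then (2 * (n : F) + l * α)⁻¹ • ⁅y 0, upper S α y (l + 1) n⁆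
    else (2 * (n : F) - (l + 4) + l * α)⁻¹ • ⁅y 1, upper S α y (l + 1) (n - 1)⁆

namespace IsLocalPart

variable {S : SuSetting F L} {α : F} {x y : ℤ → L}

lemma exists_upper_eq [CharZero F] (S : SuSetting F L) (α : F) (y : ℤ → L) (m : ℕ) (n : ℤ) :
    ∃ i k : ℤ, i + k = n ∧ 2 * (k : F) - (m + 2) * i + m * α ≠ 0 ∧
      upper S α y (m + 2) n
        = (2 * (k : F) - (m + 2) * i + m * α)⁻¹ • ⁅y i, upper S α y (m + 1) k⁆ := by
  by_cases hn : 2 * (n : F) + m * α ≠ 0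
  · refine ⟨0, n, zero_add n, by simpa using hn, ?_⟩
    rw [upper, if_pos hn]
    simp
  · have hc : 2 * ((n - 1 : ℤ) : F) - (m + 2) * (1 : ℤ) + m * α
        = 2 * (n : F) - (m + 4) + m * α := by
      push_cast; ring
    refine ⟨1, n - 1, by ring, ?_, ?_⟩
    · rw [hc]
      rw [not_not] at hn
      have : (m : F) + 4 ≠ 0 := by exact_mod_cast (by omega : m + 4 ≠ 0)
      intro h
      apply this
      linear_combination hn - h
    · rw [upper, if_neg hn, hc]

lemma upper_spec [CharZero F] (h : S.IsLocalPart α x y) (m : ℕ) :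
    (∀ n, upper S α y (m + 1) n ∈ S.comp (n, ((m + 1 : ℕ) : ℤ))) ∧
    (∀ n, upper S α y (m + 1) n ≠ 0) ∧
    (∀ a k n : ℤ, a + k = n → ⁅S.e a, upper S α y (m + 1) k⁆
      = ((k : F) - (m + 2) * a + (m + 1) * α) • upper S α y (m + 1) n) ∧
    (∀ i k n : ℤ, i + k = n → ⁅y i, upper S α y m k⁆
      = (2 * (k : F) - (m + 1) * i + (m - 1) * α) • upper S α y (m + 1) n) ∧
    (∀ j k n : ℤ, j + k = n → ⁅x j, upper S α y (m + 1) k⁆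
      = ((m + 2) * (α - j)) • upper S α y m n) := by
  induction m with
  | zero =>
    refine ⟨h.y_mem, h.y_ne, fun a k n hn => ?_, fun i k n hn => ?_, fun j k n hn => ?_⟩
    · simp only [upper]
      rw [h.e_y a k n hn]
      push_cast
      module
    · simp only [upper]
      rw [h.y_e i k n hn]
      push_cast
      module
    · simp only [upper]
      rw [h.x_y j k n hn]
      push_cast
      module
  | succ m ih =>
    obtain ⟨mem, ne, eP, yP, xP⟩ := ih
    have key : ∀ i j k n : ℤ, i + j + k = n → ⁅x j, ⁅y i, upper S α y (m + 1) k⁆⁆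
        = ((m + 3) * (α - j) * (2 * (k : F) - (m + 2) * i + m * α)) • upper S α y (m + 1) n := by
      intro i j k n hn
      rw [leibniz_lie, h.x_y j i (i + j) (by ring), smul_lie, eP (i + j) k n hn,
        xP j k (j + k) rfl, lie_smul, yP i (j + k) n (by rw [← hn]; ring)]
      push_cast
      module
    have mem' : ∀ n, upper S α y (m + 1 + 1) n ∈ S.comp (n, ((m + 1 + 1 : ℕ) : ℤ)) := by
      intro n
      obtain ⟨i, k, hik, -, hP⟩ := exists_upper_eq S α y m n
      rw [hP]
      exact Submodule.smul_mem _ _ (S.lie_mem_comp (h.y_mem i) (mem k) hik (by push_cast; ring))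
    have xP' : ∀ j k n : ℤ, j + k = n → ⁅x j, upper S α y (m + 1 + 1) k⁆
        = ((m + 3) * (α - j)) • upper S α y (m + 1) n := by
      intro j k n hn
      obtain ⟨i, l, hil, hc, hP⟩ := exists_upper_eq S α y m k
      rw [hP, lie_smul, key i j l n (by omega), smul_smul]
      congr 1
      field_simp
    have hm3 : (m : F) + 3 ≠ 0 := by exact_mod_cast (by omega : m + 3 ≠ 0)
    have hx0 : ∀ n, ⁅x 0, upper S α y (m + 1 + 1) n⁆ ≠ 0 := by
      intro n
      rw [xP' 0 n n (zero_add n), Int.cast_zero, sub_zero]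
      exact smul_ne_zero (mul_ne_zero hm3 h.α_ne) (ne n)
    refine ⟨mem', fun n h0 => hx0 n (by rw [h0, lie_zero]), fun a k n hn => ?_,
      fun i k n hn => ?_, fun j k n hn => ?_⟩
    · refine S.eq_smul_of_lie_eq (mem' n)
        (S.lie_mem_comp (S.e_mem a) (mem' k) hn (zero_add _)) (hx0 n) ?_
      rw [leibniz_lie, h.x_e 0 a a (zero_add a), smul_lie, xP' a k n hn, xP' 0 k k (zero_add k),
        lie_smul, eP a k n hn, xP' 0 n n (zero_add n)]
      push_cast
      module
    · refine S.eq_smul_of_lie_eq (mem' n)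
        (S.lie_mem_comp (h.y_mem i) (mem k) hn (by push_cast; ring)) (hx0 n) ?_
      rw [key i 0 k n (by rw [add_zero, hn]), xP' 0 n n (zero_add n)]
      push_cast
      module
    · rw [xP' j k n hn]
      push_cast
      module

end IsLocalPart

/-- The basis of the levels `≤ -2`, built from `A₋₂` by applying `x 0`. -/
def descend (α : F) (x M : ℤ → L) : ℕ → ℤ → L
  | 0, n => M n
  | m + 1, n => (-α)⁻¹ • ⁅x 0, descend α x M m n⁆

/-- A local part together with a basis of `A₋₂`. -/
structure IsExtendedLocalPart (S : SuSetting F L) (α : F) (x y M : ℤ → L) : Prop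
    extends IsLocalPart S α x y where
  M_mem : ∀ s, M s ∈ S.comp (s, -2)
  M_ne : ∀ s, M s ≠ 0
  x_x : ∀ k l n : ℤ, k + l = n → ⁅x k, x l⁆ = ((l : F) - k) • M n

namespace IsExtendedLocalPart

variable {S : SuSetting F L} {α : F} {x y M : ℤ → L}

lemma exists_M_eq [CharZero F] (h : S.IsExtendedLocalPart α x y M) (s : ℤ) :
    ∃ k l : ℤ, k + l = s ∧ (l : F) - k ≠ 0 ∧ M s = ((l : F) - k)⁻¹ • ⁅x k, x l⁆ := by
  obtain ⟨k, hk⟩ : ∃ k : ℤ, s - k - k ≠ 0 := by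
    by_cases hs : s = 0
    · exact ⟨1, by omega⟩
    · exact ⟨0, by omega⟩
  have hk' : ((s - k : ℤ) : F) - k ≠ 0 := by exact_mod_cast hk
  exact ⟨k, s - k, by ring, hk', by
    rw [h.x_x k (s - k) s (by ring), smul_smul, inv_mul_cancel₀ hk', one_smul]⟩

lemma y_M [CharZero F] (h : S.IsExtendedLocalPart α x y M) (j s : ℤ) : ⁅y j, M s⁆ = 0 := by
  obtain ⟨k, l, -, -, hM⟩ := h.exists_M_eq s
  rw [hM, lie_smul, h.y_xx, smul_zero]

lemma e_M [CharZero F] (h : S.IsExtendedLocalPart α x y M) (i s n : ℤ) (hn : i + s = n) :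
    ⁅S.e i, M s⁆ = ((s : F) + i - 2 * α) • M n := by
  obtain ⟨k, l, hkl, hc, hM⟩ := h.exists_M_eq s
  have h1 := h.e_xx k l n
  rw [show n - k - l = i by omega, h.x_x (n - l) l n (by ring), h.x_x k (n - k) n (by ring)] at h1
  rw [hM, lie_smul, h1, ← hn, ← hkl, smul_smul, smul_smul, ← add_smul, smul_smul]
  congr 1
  push_cast
  field_simp
  ring

lemma descend_step [CharZero F] (h : S.IsExtendedLocalPart α x y M) (m : ℕ)
    (mem : ∀ n, descend α x M m n ∈ S.comp (n, -((m + 2 : ℕ) : ℤ)))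
    (ne : ∀ n, descend α x M m n ≠ 0)
    (key : ∀ i j k n : ℤ, i + j + k = n → ⁅y j, ⁅x i, descend α x M m k⁆⁆
      = (((i : F) - α) * ((m + 1) * (2 * (k + i : F) + (m + 2) * j - (m + 4) * α)))
        • descend α x M m n) :
    (∀ n, descend α x M (m + 1) n ∈ S.comp (n, -((m + 1 + 2 : ℕ) : ℤ))) ∧
    (∀ n, descend α x M (m + 1) n ≠ 0) ∧
    (∀ j k n : ℤ, j + k = n → ⁅y j, descend α x M (m + 1) k⁆
      = ((m + 1) * (2 * (k : F) + (m + 2) * j - (m + 4) * α)) • descend α x M m n) ∧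
    (∀ i k n : ℤ, i + k = n → ⁅x i, descend α x M m k⁆
      = ((i : F) - α) • descend α x M (m + 1) n) := by
  have hα := h.α_ne
  have mem' : ∀ n, descend α x M (m + 1) n ∈ S.comp (n, -((m + 1 + 2 : ℕ) : ℤ)) := fun n =>
    Submodule.smul_mem _ _ (S.lie_mem_comp (h.x_mem 0) (mem n) (zero_add n) (by push_cast; ring))
  have yN : ∀ j k n : ℤ, j + k = n → ⁅y j, descend α x M (m + 1) k⁆
      = ((m + 1) * (2 * (k : F) + (m + 2) * j - (m + 4) * α)) • descend α x M m n := by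
    intro j k n hn
    rw [descend, lie_smul, key 0 j k n (by omega), smul_smul]
    congr 1
    push_cast
    field_simp
    ring
  have hm1 : (m : F) + 1 ≠ 0 := by exact_mod_cast (by omega : m + 1 ≠ 0)
  have hm2 : (m : F) + 2 ≠ 0 := by exact_mod_cast (by omega : m + 2 ≠ 0)
  have hy : ∀ n, ∃ j : ℤ, ⁅y j, descend α x M (m + 1) n⁆ ≠ 0 := by
    intro n
    by_cases hn : 2 * (n : F) - (m + 4) * α = 0
    · refine ⟨1, ?_⟩
      rw [yN 1 n _ rfl]
      refine smul_ne_zero (mul_ne_zero hm1 ?_) (ne _)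
      push_cast
      intro h0
      exact hm2 (by linear_combination h0 - hn)
    · refine ⟨0, ?_⟩
      rw [yN 0 n _ rfl]
      refine smul_ne_zero (mul_ne_zero hm1 ?_) (ne _)
      push_cast
      rwa [mul_zero, add_zero]
  refine ⟨mem', fun n h0 => ?_, yN, fun i k n hn => ?_⟩
  · obtain ⟨j, hj⟩ := hy n
    exact hj (by rw [h0, lie_zero])
  · obtain ⟨j, hj⟩ := hy n
    refine S.eq_smul_of_lie_eq (mem' n)
      (S.lie_mem_comp (h.x_mem i) (mem k) hn (by push_cast; ring)) hj ?_
    rw [key i j k (j + n) (by omega), yN j n _ rfl, ← hn, smul_smul]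
    push_cast
    congr 1
    ring

lemma descend_key [CharZero F] (h : S.IsExtendedLocalPart α x y M) (m : ℕ) :
    (∀ n, descend α x M m n ∈ S.comp (n, -((m + 2 : ℕ) : ℤ))) ∧
    (∀ n, descend α x M m n ≠ 0) ∧
    (∀ a k n : ℤ, a + k = n → ⁅S.e a, descend α x M m k⁆
      = ((k : F) + (m + 1) * a - (m + 2) * α) • descend α x M m n) ∧
    (∀ i j k n : ℤ, i + j + k = n → ⁅y j, ⁅x i, descend α x M m k⁆⁆
      = (((i : F) - α) * ((m + 1) * (2 * (k + i : F) + (m + 2) * j - (m + 4) * α)))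
        • descend α x M m n) := by
  have hα := h.α_ne
  induction m with
  | zero =>
    refine ⟨h.M_mem, h.M_ne, fun a k n hn => ?_, fun i j k n hn => ?_⟩
    · simp only [descend]
      rw [h.e_M a k n hn]
      push_cast
      module
    · simp only [descend]
      rw [leibniz_lie, h.y_x j i _ rfl, smul_lie, h.e_M (j + i) k n (by omega), h.y_M, lie_zero]
      push_cast
      module
  | succ m ih =>
    obtain ⟨mem, ne, eN, key⟩ := ih
    obtain ⟨mem', ne', yN', xN⟩ := h.descend_step m mem ne key
    have eN' : ∀ a k n : ℤ, a + k = n → ⁅S.e a, descend α x M (m + 1) k⁆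
        = ((k : F) + (m + 2) * a - (m + 3) * α) • descend α x M (m + 1) n := by
      intro a k n hn
      rw [descend, lie_smul, leibniz_lie, h.e_x a 0 a (add_zero a), smul_lie, xN a k n hn,
        eN a k n hn, lie_smul, xN 0 n n (zero_add n), smul_smul, smul_smul, ← add_smul, smul_smul]
      congr 1
      push_cast
      field_simp
      ring
    refine ⟨mem', ne', fun a k n hn => ?_, fun i j k n hn => ?_⟩
    · rw [eN' a k n hn]
      push_cast
      module
    · rw [leibniz_lie, h.y_x j i _ rfl, smul_lie, eN' (j + i) k n (by omega), yN' j k _ rfl,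
        lie_smul, xN i (j + k) n (by omega)]
      push_cast
      module

lemma descend_spec [CharZero F] (h : S.IsExtendedLocalPart α x y M) (m : ℕ) :
    (∀ n, descend α x M m n ∈ S.comp (n, -((m + 2 : ℕ) : ℤ))) ∧
    (∀ n, descend α x M m n ≠ 0) ∧
    (∀ a k n : ℤ, a + k = n → ⁅S.e a, descend α x M m k⁆
      = ((k : F) + (m + 1) * a - (m + 2) * α) • descend α x M m n) ∧
    (∀ j k n : ℤ, j + k = n → ⁅y j, descend α x M m k⁆
      = (m * (2 * (k : F) + (m + 1) * j - (m + 3) * α)) • descend α x M (m - 1) n) ∧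
    (∀ i k n : ℤ, i + k = n → ⁅x i, descend α x M m k⁆
      = ((i : F) - α) • descend α x M (m + 1) n) := by
  obtain ⟨mem, ne, eN, key⟩ := h.descend_key m
  refine ⟨mem, ne, eN, fun j k n hn => ?_, (h.descend_step m mem ne key).2.2.2⟩
  cases m with
  | zero =>
    simp only [descend]
    rw [h.y_M, Nat.cast_zero, zero_mul, zero_smul]
  | succ m =>
    obtain ⟨mem₀, ne₀, -, key₀⟩ := h.descend_key m
    rw [(h.descend_step m mem₀ ne₀ key₀).2.2.1 j k n hn, Nat.add_sub_cancel]
    push_cast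
    module

end IsExtendedLocalPart

end SuSetting

namespace SuSetting

variable {F : Type*} [Field F] [CharZero F] {L : Type*} [LieRing L] [LieAlgebra F L]

namespace IsLocalPart

variable {S : SuSetting F L} {α : F} {x y : ℤ → L}

lemma upper_mem (h : S.IsLocalPart α x y) (m : ℕ) (n : ℤ) :
    upper S α y m n ∈ S.comp (n, (m : ℤ)) := by
  cases m with
  | zero => exact S.e_mem n
  | succ m => exact (h.upper_spec m).1 n

lemma upper_ne (h : S.IsLocalPart α x y) (m : ℕ) (n : ℤ) : upper S α y m n ≠ 0 := by
  cases m with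
  | zero => exact S.e_ne n
  | succ m => exact (h.upper_spec m).2.1 n

lemma e_upper (h : S.IsLocalPart α x y) (m : ℕ) (a k n : ℤ) (hn : a + k = n) :
    ⁅S.e a, upper S α y m k⁆ = ((k : F) - (m + 1) * a + m * α) • upper S α y m n := by
  cases m with
  | zero =>
    simp only [upper]
    rw [S.e_br, hn]
    push_cast
    module
  | succ m =>
    rw [(h.upper_spec m).2.2.1 a k n hn]
    push_cast
    module

lemma x_upper (h : S.IsLocalPart α x y) (m : ℕ) (j k n : ℤ) (hn : j + k = n) :
    ⁅x j, upper S α y (m + 1) k⁆ = ((m + 2) * (α - j)) • upper S α y m n :=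
  (h.upper_spec m).2.2.2.2 j k n hn

lemma upper_x (h : S.IsLocalPart α x y) (m : ℕ) (k j n : ℤ) (hn : k + j = n) :
    ⁅upper S α y (m + 1) k, x j⁆ = ((m + 2) * ((j : F) - α)) • upper S α y m n := by
  rw [← lie_skew, h.x_upper m j k n (by omega)]
  module

lemma upper_upper (h : S.IsLocalPart α x y) (s j l : ℕ) (hs : j + l = s) (i k n : ℤ)
    (hn : i + k = n) : ⁅upper S α y j i, upper S α y l k⁆
      = ((k : F) * (j + 1) - (l + 1) * i + (l - j) * α) • upper S α y s n := by
  induction s generalizing j l i k n with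
  | zero =>
    obtain rfl : j = 0 := by omega
    obtain rfl : l = 0 := by omega
    rw [upper, h.e_upper 0 i k n hn]
    push_cast
    module
  | succ s ih =>
    rcases j with _ | j
    · obtain rfl : l = s + 1 := by omega
      rw [upper, h.e_upper (s + 1) i k n hn]
      push_cast
      module
    · rcases l with _ | l
      · obtain rfl : j = s := by omega
        rw [← lie_skew, upper, h.e_upper (j + 1) k i n (by omega)]
        push_cast
        module
      · have hsF : (j : F) + l + 1 = s := by
          rw [show s = j + l + 1 by omega]; push_cast; ring
        have hx := h.x_upper s 0 n n (zero_add n)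
        have hx0 : ⁅x 0, upper S α y (s + 1) n⁆ ≠ 0 := by
          rw [hx, Int.cast_zero, sub_zero]
          refine smul_ne_zero (mul_ne_zero ?_ h.α_ne) (h.upper_ne s n)
          exact_mod_cast (by omega : s + 2 ≠ 0)
        refine S.eq_smul_of_lie_eq (h.upper_mem (s + 1) n)
          (S.lie_mem_comp (h.upper_mem _ i) (h.upper_mem _ k) hn (by rw [← hs]; push_cast; rfl))
          hx0 ?_
        rw [leibniz_lie, h.x_upper j 0 i i (zero_add i), h.x_upper l 0 k k (zero_add k), smul_lie,
          lie_smul, ih j (l + 1) (by omega) i k n hn, ih (j + 1) l (by omega) i k n hn, hx, ← hsF]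
        push_cast
        module

end IsLocalPart

namespace IsExtendedLocalPart

variable {S : SuSetting F L} {α : F} {x y M : ℤ → L}

lemma descend_mem (h : S.IsExtendedLocalPart α x y M) (m : ℕ) (n : ℤ) :
    descend α x M m n ∈ S.comp (n, -((m + 2 : ℕ) : ℤ)) := (h.descend_spec m).1 n

lemma descend_ne (h : S.IsExtendedLocalPart α x y M) (m : ℕ) (n : ℤ) :
    descend α x M m n ≠ 0 := (h.descend_spec m).2.1 n

lemma x_descend (h : S.IsExtendedLocalPart α x y M) (m : ℕ) (i k n : ℤ) (hn : i + k = n) :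
    ⁅x i, descend α x M m k⁆ = ((i : F) - α) • descend α x M (m + 1) n :=
  (h.descend_spec m).2.2.2.2 i k n hn

lemma upper_M (h : S.IsExtendedLocalPart α x y M) (j : ℕ) (i s : ℤ) :
    ⁅upper S α y (j + 1) i, M s⁆ = 0 := by
  rcases j with _ | j
  · exact h.y_M i s
  · obtain ⟨b, c, -, -, hM⟩ := h.exists_M_eq s
    rw [hM, lie_smul, leibniz_lie, h.upper_x (j + 1) i b _ rfl, h.upper_x (j + 1) i c _ rfl,
      smul_lie, lie_smul, h.upper_x j (i + b) c (i + b + c) rfl,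
      h.x_upper j b (i + c) (i + b + c) (by ring)]
    module

lemma upper_descend (h : S.IsExtendedLocalPart α x y M) (m j : ℕ) (i k n : ℤ) (hn : i + k = n) :
    ⁅upper S α y j i, descend α x M m k⁆
      = ((m.descFactorial j : F) * ((k : F) * (j + 1) + (m + 1) * i - (m + 2 + j) * α))
        • descend α x M (m - j) n := by
  induction m generalizing j i k n with
  | zero =>
    rcases j with _ | j
    · rw [upper, (h.descend_spec 0).2.2.1 i k n hn]
      simp
    · rw [descend, h.upper_M, Nat.zero_descFactorial_succ]
      simp
  | succ m ih =>
    rcases j with _ | j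
    · rw [upper, (h.descend_spec (m + 1)).2.2.1 i k n hn, Nat.descFactorial_zero, Nat.sub_zero]
      push_cast
      module
    · have hα := h.α_ne
      have hx : ⁅upper S α y (j + 1) i, x 0⁆ = ((j + 2) * (-α)) • upper S α y j i := by
        rw [h.upper_x j i 0 i (add_zero i), Int.cast_zero, zero_sub]
      rw [descend, lie_smul, leibniz_lie, hx, smul_lie, ih j i k n hn, ih (j + 1) i k n hn,
        lie_smul, h.x_descend _ 0 n n (zero_add n), Nat.succ_descFactorial_succ,
        Nat.descFactorial_succ, Nat.add_sub_add_right]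
      rcases lt_trichotomy j m with hj | rfl | hj
      · rw [show m - (j + 1) + 1 = m - j by omega, smul_smul, smul_smul, ← add_smul, smul_smul]
        congr 1
        push_cast [Nat.cast_sub hj.le]
        field_simp
        ring
      · rw [Nat.sub_self, Nat.zero_mul, Nat.cast_zero, zero_mul, zero_smul, add_zero, smul_smul,
          smul_smul]
        congr 1
        push_cast
        field_simp
        ring
      · rw [Nat.descFactorial_of_lt hj]
        simp

lemma descend_descend (h : S.IsExtendedLocalPart α x y M) (m n : ℕ) (i k : ℤ) :
    ⁅descend α x M m i, descend α x M n k⁆ = 0 := by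
  induction m generalizing n i k with
  | zero =>
    obtain ⟨b, c, -, -, hM⟩ := h.exists_M_eq i
    rw [descend, hM, smul_lie, lie_lie, h.x_descend n c k _ rfl, h.x_descend n b k _ rfl,
      lie_smul, lie_smul, h.x_descend (n + 1) b _ (b + (c + k)) rfl,
      h.x_descend (n + 1) c _ (b + (c + k)) (by ring)]
    module
  | succ m ih =>
    rw [descend, smul_lie, lie_lie, ih, lie_zero, h.x_descend n 0 k k (zero_add k), lie_smul, ih]
    simp

end IsExtendedLocalPart

end SuSetting

lemma level_cases (j : ℤ) :
    (∃ n : ℕ, j = n) ∨ j = -1 ∨ ∃ m : ℕ, j = -((m + 2 : ℕ) : ℤ) := by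
  rcases lt_trichotomy j (-1) with hj | hj | hj
  · exact .inr (.inr ⟨(-j - 2).toNat, by omega⟩)
  · exact .inr (.inl hj)
  · exact .inl ⟨j.toNat, by omega⟩

section StructureConstants

variable {F : Type*} [Field F] (α : F)

lemma aC_antisymm (i j k l : ℤ) : aC α i j k l = -aC α k l i j := by
  unfold aC
  by_cases hj : -1 ≤ j <;> by_cases hl : -1 ≤ l
  · rw [if_pos (.inl hj), if_pos (.inl hl)]
    unfold aC0
    by_cases hjl : -1 ≤ j + l
    · rw [if_pos ⟨hj, hl, hjl⟩, if_pos ⟨hl, hj, by omega⟩]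
      push_cast
      ring
    · obtain rfl : j = -1 := by omega
      obtain rfl : l = -1 := by omega
      simp
  · rw [if_pos (.inl hj), if_neg (by omega), neg_neg]
  · rw [if_neg (by omega), if_pos (.inl hl)]
  · rw [if_pos (.inr (by omega)), if_pos (.inr (by omega))]
    unfold aC0
    simp only [if_neg (show ¬(-1 ≤ j ∧ -1 ≤ l ∧ -1 ≤ j + l) by omega),
      if_neg (show ¬(j = -1 ∧ l = -1) by omega), if_neg (show ¬(0 ≤ j ∧ l ≤ -2) by omega),
      if_neg (show ¬(j = -1 ∧ l ≤ -2) by omega),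
      if_neg (show ¬(-1 ≤ l ∧ -1 ≤ j ∧ -1 ≤ l + j) by omega),
      if_neg (show ¬(l = -1 ∧ j = -1) by omega), if_neg (show ¬(0 ≤ l ∧ j ≤ -2) by omega),
      if_neg (show ¬(l = -1 ∧ j ≤ -2) by omega), neg_zero]

lemma aC_of_nonneg {j l : ℤ} (hj : -1 ≤ j) (hl : -1 ≤ l) (hjl : -1 ≤ j + l) (i k : ℤ) :
    aC α i j k l = (k : F) * (j + 1) - (l + 1) * i + (l - j) * α := by
  rw [aC, if_pos (.inl hj), aC0, if_pos ⟨hj, hl, hjl⟩]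
  push_cast
  ring

lemma aC_neg_one_neg_one (i k : ℤ) : aC α i (-1) k (-1) = (k : F) - i := by
  simp [aC, aC0]

lemma aC_neg_one_of_le {l : ℤ} (hl : l ≤ -2) (i k : ℤ) : aC α i (-1) k l = (i : F) - α := by
  rw [aC, if_pos (.inl le_rfl), aC0, if_neg (by omega), if_neg (by omega), if_neg (by omega),
    if_pos ⟨rfl, hl⟩]
  ring

lemma aC_neg_neg {j l : ℤ} (hj : j ≤ -2) (hl : l ≤ -2) (i k : ℤ) : aC α i j k l = 0 := by
  rw [aC, if_pos (.inr hl), aC0, if_neg (by omega), if_neg (by omega), if_neg (by omega),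
    if_neg (by omega)]

lemma aC_nonneg_neg (j m : ℕ) (i k : ℤ) : aC α i j k (-((m + 2 : ℕ) : ℤ))
    = (m.descFactorial j : F) * ((k : F) * (j + 1) + (m + 1) * i - (m + 2 + j) * α) := by
  rw [aC, if_pos (.inl (by omega)), aC0, if_neg (by omega), if_neg (by omega),
    if_pos ⟨by omega, by omega⟩]
  by_cases hjm : j ≤ m
  · rw [if_pos (by omega), Nat.descFactorial_eq_div hjm,
      show (-(-((m + 2 : ℕ) : ℤ)) - 2).toNat = m by omega,
      show (-(-((m + 2 : ℕ) : ℤ)) - (j : ℤ) - 2).toNat = m - j by omega]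
    push_cast
    ring
  · rw [if_neg (by omega), Nat.descFactorial_of_lt (by omega), Nat.cast_zero, zero_mul]

end StructureConstants

namespace SuSetting

variable {F : Type*} [Field F] {L : Type*} [LieRing L] [LieAlgebra F L]

/-- The homogeneous basis of the algebra; the arguments are the level and the degree. -/
def fullBasis (S : SuSetting F L) (α : F) (x y M : ℤ → L) : ℤ → ℤ → L
  | Int.ofNat n => upper S α y n
  | Int.negSucc 0 => x
  | Int.negSucc (m + 1) => descend α x M m

section

variable (S : SuSetting F L) (α : F) (x y M : ℤ → L)

lemma fullBasis_natCast (n : ℕ) : fullBasis S α x y M n = upper S α y n := rfl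

lemma fullBasis_neg_one : fullBasis S α x y M (-1) = x := rfl

lemma fullBasis_neg (m : ℕ) :
    fullBasis S α x y M (-((m + 2 : ℕ) : ℤ)) = descend α x M m := rfl

end

namespace IsExtendedLocalPart

variable [CharZero F] {S : SuSetting F L} {α : F} {x y M : ℤ → L}

lemma fullBasis_mem (h : S.IsExtendedLocalPart α x y M) (l k : ℤ) :
    fullBasis S α x y M l k ∈ S.comp (k, l) := by
  obtain ⟨n, rfl⟩ | rfl | ⟨m, rfl⟩ := level_cases l
  · exact h.upper_mem n k
  · exact h.x_mem k
  · exact h.descend_mem m k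

lemma fullBasis_ne (h : S.IsExtendedLocalPart α x y M) (l k : ℤ) :
    fullBasis S α x y M l k ≠ 0 := by
  obtain ⟨n, rfl⟩ | rfl | ⟨m, rfl⟩ := level_cases l
  · exact h.upper_ne n k
  · rw [fullBasis_neg_one]
    intro h0
    have h1 := h.x_x k (k + 1) _ rfl
    rw [h0, zero_lie] at h1
    refine smul_ne_zero ?_ (h.M_ne _) h1.symm
    push_cast
    simp
  · exact h.descend_ne m k

lemma fullBasis_lie (h : S.IsExtendedLocalPart α x y M) (j l i k : ℤ) :
    ⁅fullBasis S α x y M j i, fullBasis S α x y M l k⁆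
      = aC α i j k l • fullBasis S α x y M (j + l) (i + k) := by
  have flip : ∀ {j l i k : ℤ}, ⁅fullBasis S α x y M l k, fullBasis S α x y M j i⁆
      = aC α k l i j • fullBasis S α x y M (l + j) (k + i) →
      ⁅fullBasis S α x y M j i, fullBasis S α x y M l k⁆
      = aC α i j k l • fullBasis S α x y M (j + l) (i + k) := by
    intro j l i k h1
    rw [← lie_skew, h1, aC_antisymm α i, add_comm l, add_comm k, neg_smul]
  have upper_neg_one : ∀ (n : ℕ) (i k : ℤ),
      ⁅fullBasis S α x y M n i, fullBasis S α x y M (-1) k⁆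
      = aC α i n k (-1) • fullBasis S α x y M (n + -1) (i + k) := by
    intro n i k
    rw [aC_of_nonneg α (by omega) (by omega) (by omega), fullBasis_natCast, fullBasis_neg_one]
    rcases n with _ | n
    · rw [upper, h.e_x i k _ rfl, Nat.cast_zero, zero_add, fullBasis_neg_one]
      push_cast
      module
    · rw [h.upper_x n i k _ rfl, show ((n + 1 : ℕ) : ℤ) + -1 = n by push_cast; ring,
        fullBasis_natCast]
      push_cast
      module
  have upper_neg : ∀ (n m : ℕ) (i k : ℤ),
      ⁅fullBasis S α x y M n i, fullBasis S α x y M (-((m + 2 : ℕ) : ℤ)) k⁆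
      = aC α i n k (-((m + 2 : ℕ) : ℤ)) • fullBasis S α x y M (n + -((m + 2 : ℕ) : ℤ)) (i + k) := by
    intro n m i k
    rw [aC_nonneg_neg, fullBasis_natCast, fullBasis_neg, h.upper_descend m n i k _ rfl]
    by_cases hn : n ≤ m
    · rw [show (n : ℤ) + -((m + 2 : ℕ) : ℤ) = -((m - n + 2 : ℕ) : ℤ) by omega, fullBasis_neg]
    · rw [Nat.descFactorial_of_lt (by omega), Nat.cast_zero, zero_mul, zero_smul, zero_smul]
  have neg_one_neg : ∀ (m : ℕ) (i k : ℤ),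
      ⁅fullBasis S α x y M (-1) i, fullBasis S α x y M (-((m + 2 : ℕ) : ℤ)) k⁆
      = aC α i (-1) k (-((m + 2 : ℕ) : ℤ)) •
        fullBasis S α x y M (-1 + -((m + 2 : ℕ) : ℤ)) (i + k) := by
    intro m i k
    rw [aC_neg_one_of_le α (by omega), fullBasis_neg_one, fullBasis_neg,
      show -1 + -((m + 2 : ℕ) : ℤ) = -((m + 1 + 2 : ℕ) : ℤ) by omega, fullBasis_neg,
      h.x_descend m i k _ rfl]
  obtain ⟨n, rfl⟩ | rfl | ⟨m, rfl⟩ := level_cases j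
  · obtain ⟨n', rfl⟩ | rfl | ⟨m', rfl⟩ := level_cases l
    · rw [aC_of_nonneg α (by omega) (by omega) (by omega), ← Nat.cast_add, fullBasis_natCast,
        fullBasis_natCast, fullBasis_natCast, h.upper_upper _ n n' rfl i k _ rfl]
      push_cast
      rfl
    · exact upper_neg_one n i k
    · exact upper_neg n m' i k
  · obtain ⟨n', rfl⟩ | rfl | ⟨m', rfl⟩ := level_cases l
    · exact flip (upper_neg_one n' k i)
    · rw [aC_neg_one_neg_one, fullBasis_neg_one, h.x_x i k _ rfl]
      rfl
    · exact neg_one_neg m' i k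
  · obtain ⟨n', rfl⟩ | rfl | ⟨m', rfl⟩ := level_cases l
    · exact flip (upper_neg n' m k i)
    · exact flip (neg_one_neg m k i)
    · rw [aC_neg_neg α (by omega) (by omega), fullBasis_neg, fullBasis_neg, h.descend_descend,
        zero_smul]

/-- An algebra with an extended local part is isomorphic to `C(α)`. -/
lemma gradedIsoTo (h : S.IsExtendedLocalPart α x y M) :
    GradedIsoTo F L S.comp (brkt (cC α))
      (fun p => Submodule.span F {Finsupp.single p (1 : F)}) := by
  obtain ⟨v, hv⟩ : ∃ v : ℤ × ℤ → L, ∀ p, v p = fullBasis S α x y M p.2 p.1 := ⟨_, fun _ => rfl⟩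
  have hspan : ∀ p, S.comp p = Submodule.span F {v p} := fun p => by
    rw [hv]
    exact S.comp_eq_span (h.fullBasis_mem p.2 p.1) (h.fullBasis_ne p.2 p.1)
  have hli : LinearIndependent F v :=
    S.internal.submodule_iSupIndep.linearIndependent S.comp
      (fun p => by rw [hspan]; exact Submodule.mem_span_singleton_self _)
      (fun p => by rw [hv]; exact h.fullBasis_ne p.2 p.1)
  have htop : ⊤ ≤ Submodule.span F (Set.range v) := by
    rw [← S.internal.submodule_iSup_eq_top]
    refine iSup_le fun p => ?_
    rw [hspan]
    exact Submodule.span_mono (Set.singleton_subset_iff.mpr ⟨p, rfl⟩)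
  let b := Module.Basis.mk hli htop
  have hb : ∀ p, b p = v p := fun p => Module.Basis.mk_apply hli htop p
  have hlie : ∀ p q, ⁅b p, b q⁆ = aC α p.1 p.2 q.1 q.2 • b (p + q) := by
    intro p q
    rw [hb, hb, hb, hv, hv, hv, h.fullBasis_lie]
    rfl
  refine ⟨b.repr, fun z w => ?_, fun p => ?_⟩
  · conv_lhs => rw [← b.linearCombination_repr z, ← b.linearCombination_repr w]
    generalize b.repr z = f
    generalize b.repr w = g
    simp only [Finsupp.linearCombination_apply, Finsupp.sum, brkt,
      sum_lie, lie_sum, smul_lie, lie_smul, map_sum, map_smul, hlie,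
      Module.Basis.repr_self, cC, smul_smul, Finsupp.smul_single, Finset.smul_sum, smul_eq_mul,
      mul_one]
    rw [Finset.sum_comm]
    refine Finset.sum_congr rfl fun p _ => Finset.sum_congr rfl fun q _ => ?_
    congr 1
    ring
  · rw [hspan, Submodule.map_span, Set.image_singleton, ← hb]
    simp

end IsExtendedLocalPart

end SuSetting

/-- A `1`-cochain on the Witt algebra relation vanishing at `±1` vanishes on positive integers. -/
lemma cochain_eq_zero_of_pos {F V : Type*} [Field F] [CharZero F] [AddCommGroup V] [Module F V]
    {d : ℤ → V} (hd : ∀ i j : ℤ, i ≠ 0 → j ≠ 0 → i + j ≠ 0 →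
      ((i : F) + j) • (d j - d i) = ((j : F) - i) • d (i + j))
    (h1 : d 1 = 0) (hm1 : d (-1) = 0) (n : ℕ) : d ((n : ℤ) + 1) = 0 := by
  induction n with
  | zero => simpa using h1
  | succ n ih =>
    rcases n with _ | n
    · have h2 := hd 2 (-1) (by decide) (by decide) (by decide)
      rw [show (2 : ℤ) + -1 = 1 by rfl, h1, hm1] at h2
      push_cast at h2
      rw [show (((0 + 1 : ℕ) : ℤ) + 1) = 2 by rfl]
      linear_combination (norm := module) -h2
    · have h2 := hd (((n + 1 : ℕ) : ℤ) + 1) 1 (by omega) one_ne_zero (by omega)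
      rw [ih, h1, sub_zero, smul_zero] at h2
      refine (smul_eq_zero.mp h2.symm).resolve_left ?_
      rw [← Int.cast_sub]
      exact Int.cast_ne_zero.mpr (by omega)

/-- Solutions of the cochain relation are quadratic without constant term. -/
lemma cochain_eq_quadratic {F V : Type*} [Field F] [CharZero F] [AddCommGroup V] [Module F V]
    {c : ℤ → V} (hc : ∀ i j : ℤ, i ≠ 0 → j ≠ 0 → i + j ≠ 0 →
      ((i : F) + j) • (c j - c i) = ((j : F) - i) • c (i + j)) :
    ∃ a b : V, ∀ i : ℤ, i ≠ 0 → c i = (i : F) • a + ((i : F) ^ 2) • b := by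
  obtain ⟨a, ha⟩ : ∃ a : V, a = (2 : F)⁻¹ • (c 1 - c (-1)) := ⟨_, rfl⟩
  obtain ⟨b, hb⟩ : ∃ b : V, b = (2 : F)⁻¹ • (c 1 + c (-1)) := ⟨_, rfl⟩
  refine ⟨a, b, ?_⟩
  obtain ⟨d, hd⟩ : ∃ d : ℤ → V, ∀ i, d i = c i - ((i : F) • a + ((i : F) ^ 2) • b) :=
    ⟨_, fun _ => rfl⟩
  have hrel : ∀ i j : ℤ, i ≠ 0 → j ≠ 0 → i + j ≠ 0 →
      ((i : F) + j) • (d j - d i) = ((j : F) - i) • d (i + j) := by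
    intro i j hi hj hij
    rw [hd, hd, hd]
    push_cast
    linear_combination (norm := module) hc i j hi hj hij
  have h1 : d 1 = 0 := by
    rw [hd, ha, hb]
    push_cast
    module
  have hm1 : d (-1) = 0 := by
    rw [hd, ha, hb]
    push_cast
    module
  have hpos := cochain_eq_zero_of_pos hrel h1 hm1
  have hneg := cochain_eq_zero_of_pos (F := F) (d := fun i => d (-i)) (by
    intro i j hi hj hij
    have := hrel (-i) (-j) (by omega) (by omega) (by omega)
    rw [← neg_add] at this
    push_cast at this
    linear_combination (norm := module) -this) hm1 (by simpa using h1)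
  intro i hi
  have hdi : d i = 0 := by
    rcases lt_or_gt_of_ne hi with hi | hi
    · have := hneg (-i - 1).toNat
      rwa [show -(((-i - 1).toNat : ℤ) + 1) = i by omega] at this
    · have := hpos (i - 1).toNat
      rwa [show ((i - 1).toNat : ℤ) + 1 = i by omega] at this
  rwa [hd, sub_eq_zero] at hdi

namespace SuSetting

variable {F : Type*} [Field F] {L : Type*} [LieRing L] [LieAlgebra F L]

/-- The relations of levels `-1, 0, 1` when `α = N` is an integer, with degrees shifted by `N`
and nothing assumed about `X 0`. -/
structure IsShiftedLocalPart (S : SuSetting F L) (N : ℤ) (X Y : ℤ → L) : Prop where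
  X_mem : ∀ k, X k ∈ S.comp (N + k, -1)
  Y_mem : ∀ j, Y j ∈ S.comp (j - N, 1)
  e_X : ∀ i k n : ℤ, i + k = n → k ≠ 0 → n ≠ 0 → ⁅S.e i, X k⁆ = (k : F) • X n
  e_Y : ∀ i k n : ℤ, i + k = n → ⁅S.e i, Y k⁆ = ((k : F) - 2 * i) • Y n
  Y_X : ∀ j k n : ℤ, j + k = n → k ≠ 0 → ⁅Y j, X k⁆ = (2 * (k : F)) • S.e n

namespace IsShiftedLocalPart

variable {S : SuSetting F L} {N : ℤ} {X Y : ℤ → L}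

lemma Y_e (h : S.IsShiftedLocalPart N X Y) (k i n : ℤ) (hn : k + i = n) :
    ⁅Y k, S.e i⁆ = (2 * (i : F) - k) • Y n := by
  rw [← lie_skew, h.e_Y i k n (by omega)]
  module

/-- The elements `[e_i, X_{-i}]` of degree `(N, -1)` are killed by `A₁`. -/
lemma Y_lie (h : S.IsShiftedLocalPart N X Y) (i j : ℤ) (hi : i ≠ 0) :
    ⁅Y j, ⁅S.e i, X (-i)⁆⁆ = 0 := by
  rw [leibniz_lie, h.Y_e j i _ rfl, smul_lie, h.Y_X (j + i) (-i) j (by ring) (by omega),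
    h.Y_X j (-i) _ rfl (by omega), lie_smul, S.e_br, show i + (j + -i) = j by ring]
  push_cast
  module

lemma e_lie (h : S.IsShiftedLocalPart N X Y) (i j : ℤ) (hi : i ≠ 0) (hij : i ≠ j) :
    ⁅S.e j, ⁅S.e i, X (-i)⁆⁆ = 0 := by
  rw [leibniz_lie, S.e_br, smul_lie, h.e_X j (-i) (j - i) (by ring) (by omega) (by omega),
    lie_smul]
  by_cases hj : j = 0
  · subst hj
    rw [zero_add, zero_sub]
    push_cast
    module
  · rw [h.e_X (j + i) (-i) j (by ring) (by omega) hj, h.e_X i (j - i) j (by ring) (by omega) hj]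
    push_cast
    module

lemma Y_lie_neg (h : S.IsShiftedLocalPart N X Y) (i j : ℤ) (hi : i ≠ 0) :
    ⁅Y j, ⁅S.e (-i), X i⁆⁆ = 0 := by
  simpa using h.Y_lie (-i) j (neg_ne_zero.mpr hi)

lemma e_lie_neg (h : S.IsShiftedLocalPart N X Y) (i j : ℤ) (hi : i ≠ 0) (hij : -i ≠ j) :
    ⁅S.e j, ⁅S.e (-i), X i⁆⁆ = 0 := by
  simpa using h.e_lie (-i) j (neg_ne_zero.mpr hi) hij

/-- There is no algebra in which the cochain `[e_i, X_{-i}]` has a quadratic part. -/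
lemma quadratic_part_eq_zero [CharZero F] (h : S.IsShiftedLocalPart N X Y) {b : L}
    (hb : b ∈ S.comp (N, -1)) (eb : ∀ i, ⁅S.e i, b⁆ = 0) (Yb : ∀ j, ⁅Y j, b⁆ = 0)
    (e_X : ∀ i k n : ℤ, i + k = n → n ≠ 0 → ⁅S.e i, X k⁆ = (k : F) • X n)
    (e_X' : ∀ i : ℤ, ⁅S.e i, X (-i)⁆ = (-i : F) • X 0 + ((i : F) ^ 2) • b)
    (Y_X : ∀ j k n : ℤ, j + k = n → ⁅Y j, X k⁆ = (2 * (k : F)) • S.e n) : b = 0 := by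
  by_contra hb0
  have Y_XX : ∀ j k l : ℤ, j + k + l ≠ 0 → ⁅Y j, ⁅X k, X l⁆⁆ = 0 := by
    intro j k l hjkl
    rw [leibniz_lie, Y_X j k _ rfl, Y_X j l _ rfl, smul_lie, lie_smul, ← lie_skew (X k),
      e_X (j + k) l _ rfl hjkl, e_X (j + l) k (j + k + l) (by ring) hjkl]
    module
  have Y_XX' : ∀ k l : ℤ,
      ⁅Y (-(k + l)), ⁅X k, X l⁆⁆ = (2 * ((k : F) * l * (l - k))) • b := by
    intro k l
    have h1 := e_X' (-l)
    have h2 := e_X' (-k)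
    rw [neg_neg] at h1 h2
    rw [leibniz_lie, Y_X _ k (-l) (by ring), Y_X _ l (-k) (by ring), smul_lie, lie_smul,
      ← lie_skew (X k), h1, h2]
    push_cast
    module
  have exM : ∀ s : ℤ, ∃ m ∈ S.comp (2 * N + s, -2), ⁅Y (-s), m⁆ = (2 : F) • b ∧
      ∀ j, j ≠ -s → ⁅Y j, m⁆ = 0 := by
    intro s
    obtain ⟨k, l, hkl, hk, hl, hne⟩ : ∃ k l : ℤ, k + l = s ∧ k ≠ 0 ∧ l ≠ 0 ∧ l - k ≠ 0 :=
      ⟨s.natAbs + 1, s - (s.natAbs + 1), by omega, by omega, by omega, by omega⟩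
    have hc : (k : F) * l * (l - k) ≠ 0 := by
      exact_mod_cast mul_ne_zero (mul_ne_zero hk hl) hne
    refine ⟨((k : F) * l * (l - k))⁻¹ • ⁅X k, X l⁆, Submodule.smul_mem _ _
      (S.lie_mem_comp (h.X_mem k) (h.X_mem l) (by rw [← hkl]; ring) rfl), ?_, fun j hj => ?_⟩
    · rw [lie_smul, ← hkl, Y_XX', smul_smul]
      rw [mul_left_comm, inv_mul_cancel₀ hc, mul_one]
    · rw [lie_smul, Y_XX j k l (by omega), smul_zero]
  choose M M_mem Y_M Y_M' using exM
  have hYM : ∀ s, ⁅Y (-s), M s⁆ ≠ 0 := fun s => by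
    rw [Y_M]; exact smul_ne_zero two_ne_zero hb0
  have e_M : ∀ i s n : ℤ, i + s = n → ⁅S.e i, M s⁆ = ((s : F) + 3 * i) • M n := by
    intro i s n hn
    refine S.eq_smul_of_lie_eq (M_mem n)
      (S.lie_mem_comp (S.e_mem i) (M_mem s) (by rw [← hn]; ring) rfl) (hYM n) ?_
    have h0 : ⁅S.e i, ⁅Y (-n), M s⁆⁆ = 0 := by
      by_cases hi : i = 0
      · rw [show -n = -s by omega, Y_M, lie_smul, eb, smul_zero]
      · rw [Y_M' s (-n) (by omega), lie_zero]
    rw [leibniz_lie, h0, add_zero, h.Y_e (-n) i (-s) (by omega), smul_lie, Y_M, Y_M, ← hn]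
    push_cast
    module
  have X_b : ⁅X 1, b⁆ = 0 := by
    refine S.eq_zero_of_lie_eq_zero (M_mem 1)
      (S.lie_mem_comp (h.X_mem 1) hb (by ring) rfl) (hYM 1) ?_
    rw [leibniz_lie, Y_X _ 1 _ rfl, smul_lie, eb, Yb, lie_zero, smul_zero, add_zero]
  have M_ne : ∀ s, M s ≠ 0 := fun s h0 => hYM s (by rw [h0, lie_zero])
  have w1 : ⁅Y 0, ⁅X 1, M (-1)⁆⁆ = (4 : F) • M 0 := by
    rw [leibniz_lie, Y_X 0 1 1 rfl, Y_M' (-1) 0 (by decide), lie_zero, smul_lie,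
      e_M 1 (-1) 0 rfl]
    push_cast
    module
  have w2 : ⁅Y 0, ⁅X 2, M (-2)⁆⁆ = (16 : F) • M 0 := by
    rw [leibniz_lie, Y_X 0 2 2 rfl, Y_M' (-2) 0 (by decide), lie_zero, smul_lie,
      e_M 2 (-2) 0 rfl]
    push_cast
    module
  have v1 : ⁅Y 1, ⁅X 1, M (-1)⁆⁆ = (10 : F) • M 1 := by
    have h1 := Y_M (-1)
    rw [neg_neg] at h1
    rw [leibniz_lie, Y_X 1 1 2 rfl, h1, lie_smul, X_b, smul_lie, e_M 2 (-1) 1 rfl]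
    push_cast
    module
  have v2 : ⁅Y 1, ⁅X 2, M (-2)⁆⁆ = (28 : F) • M 1 := by
    rw [leibniz_lie, Y_X 1 2 3 rfl, Y_M' (-2) 1 (by decide), lie_zero, smul_lie,
      e_M 3 (-2) 1 rfl]
    push_cast
    module
  have hprop := S.eq_smul_of_lie_eq (d := Y 0) (c := (4 : F))
    (S.lie_mem_comp (m := 3 * N) (n := -3) (h.X_mem 1) (M_mem (-1)) (by ring) rfl)
    (S.lie_mem_comp (m := 3 * N) (n := -3) (h.X_mem 2) (M_mem (-2)) (by ring) rfl)
    (by rw [w1]; exact smul_ne_zero (by norm_num) (M_ne 0)) (by rw [w1, w2]; module)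
  rw [hprop, lie_smul, v1, smul_smul] at v2
  have := smul_left_injective F (M_ne 1) v2
  norm_num at this

/-- The degree `(N, -1)` can be normalized like all others. -/
lemma exists_normalized [CharZero F] (h : S.IsShiftedLocalPart N X Y) :
    ∃ z ∈ S.comp (N, -1), (∀ i, i ≠ 0 → ⁅S.e i, X (-i)⁆ = (-i : F) • z) ∧
      (∀ i, ⁅S.e i, z⁆ = 0) ∧ ∀ j, ⁅Y j, z⁆ = 0 := by
  obtain ⟨a, b, hab⟩ := cochain_eq_quadratic (F := F) (c := fun i => ⁅S.e i, X (-i)⁆) (by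
    intro i j hi hj hij
    have h1 := lie_lie (S.e i) (S.e j) (X (-(i + j)))
    rw [S.e_br, smul_lie, h.e_X j (-(i + j)) (-i) (by ring) (by omega) (by omega),
      h.e_X i (-(i + j)) (-j) (by ring) (by omega) (by omega), lie_smul, lie_smul] at h1
    push_cast at h1
    linear_combination (norm := module) -h1)
  have c1 := hab 1 (by decide)
  have cm1 := hab (-1) (by decide)
  have c2 := hab 2 (by decide)
  have cm2 := hab (-2) (by decide)
  push_cast at c1 cm1 c2 cm2
  have ha1 : a = (2 : F)⁻¹ • (⁅S.e 1, X (-1)⁆ - ⁅S.e (-1), X 1⁆) := by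
    rw [c1, cm1]; module
  have hb1 : b = (2 : F)⁻¹ • (⁅S.e 1, X (-1)⁆ + ⁅S.e (-1), X 1⁆) := by
    rw [c1, cm1]; module
  have ha2 : a = (4 : F)⁻¹ • (⁅S.e 2, X (-2)⁆ - ⁅S.e (-2), X 2⁆) := by
    rw [c2, cm2]; module
  have hb2 : b = (8 : F)⁻¹ • (⁅S.e 2, X (-2)⁆ + ⁅S.e (-2), X 2⁆) := by
    rw [c2, cm2]; module
  have c_mem : ∀ i : ℤ, ⁅S.e i, X (-i)⁆ ∈ S.comp (N, -1) := fun i =>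
    S.lie_mem_comp (S.e_mem i) (h.X_mem (-i)) (by ring) rfl
  have a_mem : a ∈ S.comp (N, -1) := by
    rw [ha1]; exact Submodule.smul_mem _ _ (Submodule.sub_mem _ (c_mem 1) (c_mem (-1)))
  have b_mem : b ∈ S.comp (N, -1) := by
    rw [hb1]; exact Submodule.smul_mem _ _ (Submodule.add_mem _ (c_mem 1) (c_mem (-1)))
  have ea : ∀ j, ⁅S.e j, a⁆ = 0 := by
    intro j
    by_cases hj : j = 1 ∨ j = -1
    · rw [ha2, lie_smul, lie_sub, h.e_lie 2 j (by decide) (by omega),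
        h.e_lie_neg 2 j (by decide) (by omega), sub_self, smul_zero]
    · rw [ha1, lie_smul, lie_sub, h.e_lie 1 j (by decide) (by omega),
        h.e_lie_neg 1 j (by decide) (by omega), sub_self, smul_zero]
  have eb : ∀ j, ⁅S.e j, b⁆ = 0 := by
    intro j
    by_cases hj : j = 1 ∨ j = -1
    · rw [hb2, lie_smul, lie_add, h.e_lie 2 j (by decide) (by omega),
        h.e_lie_neg 2 j (by decide) (by omega), add_zero, smul_zero]
    · rw [hb1, lie_smul, lie_add, h.e_lie 1 j (by decide) (by omega),
        h.e_lie_neg 1 j (by decide) (by omega), add_zero, smul_zero]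
  have Ya : ∀ j, ⁅Y j, a⁆ = 0 := fun j => by
    rw [ha1, lie_smul, lie_sub, h.Y_lie 1 j (by decide), h.Y_lie_neg 1 j (by decide), sub_self,
      smul_zero]
  have Yb : ∀ j, ⁅Y j, b⁆ = 0 := fun j => by
    rw [hb1, lie_smul, lie_add, h.Y_lie 1 j (by decide), h.Y_lie_neg 1 j (by decide), add_zero,
      smul_zero]
  obtain ⟨X', hX'⟩ : ∃ X' : ℤ → L, X' = Function.update X 0 (-a) := ⟨_, rfl⟩
  have X'0 : X' 0 = -a := by rw [hX', Function.update_self]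
  have X'ne : ∀ k, k ≠ 0 → X' k = X k := fun k hk => by rw [hX', Function.update_of_ne hk]
  have X'_mem : ∀ k, X' k ∈ S.comp (N + k, -1) := by
    intro k
    by_cases hk : k = 0
    · rw [hk, X'0, add_zero]; exact Submodule.neg_mem _ a_mem
    · rw [X'ne k hk]; exact h.X_mem k
  have e_X : ∀ i k n : ℤ, i + k = n → n ≠ 0 → ⁅S.e i, X' k⁆ = (k : F) • X' n := by
    intro i k n hn hn0
    by_cases hk : k = 0
    · rw [hk, X'0, lie_neg, ea, neg_zero, Int.cast_zero, zero_smul]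
    · rw [X'ne k hk, X'ne n hn0, h.e_X i k n hn hk hn0]
  have Y_X : ∀ j k n : ℤ, j + k = n → ⁅Y j, X' k⁆ = (2 * (k : F)) • S.e n := by
    intro j k n hn
    by_cases hk : k = 0
    · rw [hk, X'0, lie_neg, Ya, neg_zero, Int.cast_zero, mul_zero, zero_smul]
    · rw [X'ne k hk, h.Y_X j k n hn hk]
  have e_X' : ∀ i : ℤ, ⁅S.e i, X' (-i)⁆ = (-i : F) • X' 0 + ((i : F) ^ 2) • b := by
    intro i
    by_cases hi : i = 0
    · subst hi
      rw [neg_zero, X'0, lie_neg, ea]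
      simp
    · rw [X'ne (-i) (by omega), hab i hi, X'0]
      module
  have h' : S.IsShiftedLocalPart N X' Y :=
    ⟨X'_mem, h.Y_mem, fun i k n hn _ hn0 => e_X i k n hn hn0, h.e_Y, fun j k n hn _ => Y_X j k n hn⟩
  have hb0 : b = 0 := h'.quadratic_part_eq_zero b_mem eb Yb e_X e_X' Y_X
  refine ⟨-a, Submodule.neg_mem _ a_mem, fun i hi => ?_, fun i => ?_, fun j => ?_⟩
  · rw [hab i hi, hb0]
    module
  · rw [lie_neg, ea, neg_zero]
  · rw [lie_neg, Ya, neg_zero]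

end IsShiftedLocalPart

end SuSetting

namespace SuSetting

variable {F : Type*} [Field F] [CharZero F] {L : Type*} [LieRing L] [LieAlgebra F L]

/-- The normalized elements of `A₁` are all nonzero when one of them is. -/
lemma ne_zero_of_e_lie (S : SuSetting F L) {α : F} {y : ℤ → L} (hy0 : y 0 ≠ 0)
    (e_y : ∀ i k n : ℤ, i + k = n → ⁅S.e i, y k⁆ = ((k : F) + α - 2 * i) • y n) (k : ℤ) :
    y k ≠ 0 := by
  intro hk
  have prop : ∀ n : ℤ, 3 * (k : F) + α ≠ 2 * n → y n = 0 := by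
    intro n hn
    have h1 := e_y (n - k) k n (by ring)
    rw [hk, lie_zero] at h1
    refine (smul_eq_zero.mp h1.symm).resolve_left fun h2 => hn ?_
    push_cast at h2
    linear_combination h2
  obtain ⟨n, hn1, hn2⟩ := exists_int_ne_ne ((3 * (k : F) + α) / 2) (-α / 3)
  have hn : y n = 0 := prop n fun h0 => hn1 (by rw [h0]; field_simp)
  have h1 := e_y (-n) n 0 (by ring)
  rw [hn, lie_zero] at h1
  refine hn2 ?_
  have h2 := (smul_eq_zero.mp h1.symm).resolve_right hy0
  push_cast at h2
  field_simp
  linear_combination h2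

/-- The action of `A₀` on `A₁` and `A₋₁` determines the pairing `A₁ × A₋₁ → A₀`. -/
lemma y_x_eq (S : SuSetting F L) {α : F} {x y : ℤ → L} (hα : α ≠ 0)
    (x_mem : ∀ k, x k ∈ S.comp (k, -1)) (y_mem : ∀ k, y k ∈ S.comp (k, 1))
    (xy0 : ⁅x 0, y 0⁆ = (2 * α) • S.e 0)
    (e_x : ∀ i k n : ℤ, i + k = n → (k : F) ≠ α → (n : F) ≠ α → ⁅S.e i, x k⁆ = ((k : F) - α) • x n)
    (e_y : ∀ i k n : ℤ, i + k = n → ⁅S.e i, y k⁆ = ((k : F) + α - 2 * i) • y n)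
    (j k n : ℤ) (hn : j + k = n) (hk : (k : F) ≠ α) :
    ⁅y j, x k⁆ = (2 * ((k : F) - α)) • S.e n := by
  have hex : ∀ k j : ℤ, ∃ c : F, ⁅x k, y j⁆ = c • S.e (k + j) := fun k j =>
    S.exists_smul_of_mem (S.e_mem (k + j)) (S.e_ne _)
      (S.lie_mem_comp (x_mem k) (y_mem j) rfl rfl)
  choose f hf using hex
  have hf0 : f 0 0 = 2 * α := by
    have h1 := hf 0 0
    rw [xy0, add_zero] at h1
    exact (smul_left_injective F (S.e_ne 0) h1).symm
  have hfk := pairing_unique hα hf0 (fun i k j hk hik => by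
    apply smul_left_injective F (S.e_ne (i + k + j))
    have h1 := leibniz_lie (S.e i) (x k) (y j)
    rw [hf, lie_smul, S.e_br, e_x i k (k + i) (add_comm _ _) hk (by push_cast; exact hik),
      e_y i j (j + i) (add_comm _ _), smul_lie, lie_smul, hf, hf,
      show i + (k + j) = i + k + j by ring,
      show k + i + j = i + k + j by ring, show k + (j + i) = i + k + j by ring] at h1
    push_cast at h1
    linear_combination (norm := module) h1) k j hk
  rw [← lie_skew, hf, hfk, ← hn, add_comm k j]
  module

/-- The degree `α`, if it is integral, can be renormalized to give a local part. -/
lemma exists_isLocalPart (S : SuSetting F L) {α : F} {x y : ℤ → L} (hα : α ≠ 0)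
    (x_mem : ∀ k, x k ∈ S.comp (k, -1)) (y_mem : ∀ k, y k ∈ S.comp (k, 1))
    (xy0 : ⁅x 0, y 0⁆ = (2 * α) • S.e 0)
    (e_x : ∀ i k n : ℤ, i + k = n → (k : F) ≠ α → (n : F) ≠ α → ⁅S.e i, x k⁆ = ((k : F) - α) • x n)
    (e_y : ∀ i k n : ℤ, i + k = n → ⁅S.e i, y k⁆ = ((k : F) + α - 2 * i) • y n) :
    ∃ x', S.IsLocalPart α x' y := by
  have hne : ⁅x 0, y 0⁆ ≠ 0 := by
    rw [xy0]
    exact smul_ne_zero (mul_ne_zero two_ne_zero hα) (S.e_ne 0)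
  have y_ne := S.ne_zero_of_e_lie (α := α) (fun h => hne (by rw [h, lie_zero])) e_y
  have y_x := S.y_x_eq hα x_mem y_mem xy0 e_x e_y
  have x_ne : ∀ k : ℤ, (k : F) ≠ α → x k ≠ 0 := by
    intro k hk h0
    have h1 := y_x 0 k k (by ring) hk
    rw [h0, lie_zero] at h1
    exact smul_ne_zero (mul_ne_zero two_ne_zero (sub_ne_zero.mpr hk)) (S.e_ne k) h1.symm
  by_cases hN : ∃ N : ℤ, (N : F) = α
  · obtain ⟨N, rfl⟩ := hN
    have hs : S.IsShiftedLocalPart N (fun k => x (N + k)) (fun j => y (j - N)) := by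
      refine ⟨fun k => x_mem _, fun j => y_mem _, fun i k n hn hk hn0 => ?_,
        fun i k n hn => ?_, fun j k n hn hk => ?_⟩
      · rw [e_x i (N + k) (N + n) (by omega) (by simpa using hk) (by simpa using hn0)]
        push_cast
        module
      · rw [e_y i (k - N) (n - N) (by omega)]
        push_cast
        module
      · rw [y_x (j - N) (N + k) n (by omega) (by simpa using hk)]
        push_cast
        module
    obtain ⟨z, z_mem, e_X, e_z, Y_z⟩ := hs.exists_normalized
    obtain ⟨x', hx'⟩ : ∃ x' : ℤ → L, x' = Function.update x N z := ⟨_, rfl⟩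
    have x'N : x' N = z := by rw [hx', Function.update_self]
    have x'ne : ∀ k, k ≠ N → x' k = x k := fun k hk => by rw [hx', Function.update_of_ne hk]
    refine ⟨x', hα, fun k => ?_, y_mem, fun k hk => ?_, y_ne, fun i k n hn => ?_, e_y,
      fun j k n hn => ?_⟩
    · by_cases hk : k = N
      · rw [hk, x'N]; exact z_mem
      · rw [x'ne k hk]; exact x_mem k
    · rw [x'ne k (fun h => hk (by rw [h]))]
      exact x_ne k hk
    · by_cases hk : k = N
      · rw [hk, x'N, e_z, sub_self, zero_smul]
      · by_cases hnN : n = N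
        · have h1 := e_X i (by omega)
          rw [show N + -i = k by omega] at h1
          rw [x'ne k hk, hnN, x'N, h1, ← hnN, ← hn]
          push_cast
          module
        · rw [x'ne k hk, x'ne n hnN, e_x i k n hn (by simpa using hk) (by simpa using hnN)]
    · by_cases hk : k = N
      · have h1 := Y_z (j + N)
        rw [add_sub_cancel_right] at h1
        rw [hk, x'N, h1, sub_self, mul_zero, zero_smul]
      · rw [x'ne k hk, y_x j k n hn (by simpa using hk)]
  · have hne' : ∀ k : ℤ, (k : F) ≠ α := fun k hk => hN ⟨k, hk⟩
    exact ⟨x, hα, x_mem, y_mem, x_ne, y_ne,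
      fun i k n hn => e_x i k n hn (hne' k) (hne' n), e_y, fun j k n hn => y_x j k n hn (hne' k)⟩

end SuSetting

/-- **Statement 18** (Lemma 4.2a). In the setting of Theorem 1.1, with normalized
elements `L_{i,0} = e i`, `L_{i,1} = Lp i`, `L_{i,−1} = Lm i`, if `β₁ = −2`, `β₋₁ = 0`
and `dim (⊕_{i∈ℤ} A_{i,−2}) ≥ 2`, then `A` is isomorphic as a ℤ×ℤ-graded Lie algebra
to `C(α)`. -/
theorem stmt_18 {F : Type*} [Field F] [CharZero F]
    {L : Type*} [LieRing L] [LieAlgebra F L] (S : SuSetting F L)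
    (α β₁ βm : F) (hα : α ≠ 0) (Lp Lm : ℤ → L)
    (hLp_mem : ∀ i : ℤ, Lp i ∈ S.comp (i, 1))
    (hLm_mem : ∀ i : ℤ, Lm i ∈ S.comp (i, -1))
    (hLp_ne : ∀ i : ℤ, S.comp (i, 1) ≠ ⊥ → Lp i ≠ 0)
    (hLm_ne : ∀ i : ℤ, S.comp (i, -1) ≠ ⊥ → Lm i ≠ 0)
    -- the normalization [L_{0,i},L_{0,j}] = (j−i)α L_{0,i+j} for −1 ≤ i,j,i+j ≤ 1
    (hsl1 : ⁅Lm 0, S.e 0⁆ = α • Lm 0)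
    (hsl2 : ⁅Lm 0, Lp 0⁆ = (2 * α) • S.e 0)
    (hsl3 : ⁅S.e 0, Lp 0⁆ = α • Lp 0)
    -- [L_{i,0}, L_{j,1}] = (α + j + β₁ i) L_{i+j,1}
    (hbp : ∀ i j : ℤ, (((j : F) + α ≠ 0 ∧ (i : F) + (j : F) + α ≠ 0) ∨
        β₁ ∉ ({0, 1} : Set F)) →
      ⁅S.e i, Lp j⁆ = (α + (j : F) + β₁ * (i : F)) • Lp (i + j))
    -- [L_{i,0}, L_{j,−1}] = (−α + j + β₋₁ i) L_{i+j,−1}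
    (hbm : ∀ i j : ℤ, (((j : F) - α ≠ 0 ∧ (i : F) + (j : F) - α ≠ 0) ∨
        βm ∉ ({0, 1} : Set F)) →
      ⁅S.e i, Lm j⁆ = (-α + (j : F) + βm * (i : F)) • Lm (i + j))
    (hcase1 : β₁ = -2) (hcase2 : βm = 0)
    (hdim : 2 ≤ Module.rank F ↥(⨆ i : ℤ, S.comp (i, -2))) :
    GradedIsoTo F L S.comp (brkt (cC α))
      (fun p => Submodule.span F {Finsupp.single p (1 : F)}) := by
  subst hcase1 hcase2
  have hmem : (-2 : F) ∉ ({0, 1} : Set F) := by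
    rintro (h | h)
    · norm_num at h
    · norm_num [Set.mem_singleton_iff, neg_eq_iff_eq_neg] at h
  obtain ⟨x, hx⟩ := S.exists_isLocalPart hα hLm_mem hLp_mem hsl2
    (by
      rintro i k n rfl hk hn
      push_cast at hn
      rw [hbm i k (Or.inl ⟨sub_ne_zero.mpr hk, sub_ne_zero.mpr hn⟩)]
      module)
    (by
      rintro i k n rfl
      rw [hbp i k (Or.inr hmem)]
      module)
  obtain ⟨k, l, hkl, hne⟩ := hx.exists_lie_ne_zero hdim
  obtain ⟨M, M_mem, M_ne, x_x⟩ := hx.exists_level_neg_two hkl hne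
  have h : S.IsExtendedLocalPart α x Lp M := ⟨hx, M_mem, M_ne, x_x⟩
  exact h.gradedIsoTo

end
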